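/- Assume f satisfies (f1), (f2), (f3) and q satisfies (q1), (q2), (q3). Then the bound state problem has at most one nonnegative solution with positive initial value: if u₁ and u₂ are solutions of (E) with u_i(r) ≥ 0 for all r ≥ 0, u_i(0) > 0 and lim_{r→∞} u_i(r) = 0 (i = 1,2), then u₁ = u₂. -/

import Mathlib

open Set Filter MeasureTheory Topology

noncomputable section

/-- `F(s) = ∫₀ˢ f(t) dt`. -/
def Fint (f : ℝ → ℝ) (s : ℝ) : ℝ := ∫ t in (0:ℝ)..s, f t

/-- `s ∈ (−c, c)` where `c ∈ (0, ∞]` is viewed as an extended real. -/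
def InCC (c : EReal) (s : ℝ) : Prop := -c < (s : EReal) ∧ (s : EReal) < c

/-- A solution of equation (E):  `u'' + (q'/q) u' + f(u) = 0` on `(0,∞)`,
`u` with values in `(−c,c)`, `C¹` on `[0,∞)`, twice differentiable on `(0,∞)`,
and `u'(0) = 0`. -/
structure IsSolutionE (c : EReal) (f q u : ℝ → ℝ) : Prop where
  mem : ∀ r : ℝ, 0 ≤ r → InCC c (u r)
  c1 : ContDiffOn ℝ 1 u (Ici (0:ℝ))
  diff2 : ∀ r : ℝ, 0 < r → DifferentiableAt ℝ (deriv u) r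
  ode : ∀ r : ℝ, 0 < r →
    deriv (deriv u) r + (deriv q r / q r) * deriv u r + f (u r) = 0
  d0 : deriv u 0 = 0

/-- Condition (f1). -/
def CondF1 (c : EReal) (f : ℝ → ℝ) (b β : ℝ) : Prop :=
  (∀ s : ℝ, f (-s) = - f s) ∧ f 0 = 0 ∧
  0 < b ∧ b < β ∧ (β : EReal) < c ∧
  (∀ s : ℝ, b < s → (s : EReal) < c → 0 < f s) ∧
  (∀ s : ℝ, s ∈ Icc (0:ℝ) b → f s ≤ 0) ∧
  (∃ s ∈ Icc (0:ℝ) b, f s ≠ 0) ∧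
  Fint f β = 0

/-- Condition (f2). -/
def CondF2 (c : EReal) (f : ℝ → ℝ) : Prop :=
  ContDiffOn ℝ 1 f {s : ℝ | 0 < s ∧ (s : EReal) < c} ∧
  IntegrableOn (deriv f) (Ioo (0:ℝ) 1)

/-- Condition (q1). -/
def CondQ1 (q : ℝ → ℝ) : Prop :=
  ContDiffOn ℝ 1 q (Ioi (0:ℝ)) ∧
  (∀ r : ℝ, 0 < r → 0 < q r ∧ 0 < deriv q r) ∧
  q 0 = 0 ∧ ContinuousWithinAt q (Ici (0:ℝ)) 0

/-- Condition (q2). -/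
def CondQ2 (q : ℝ → ℝ) : Prop :=
  StrictAntiOn (fun r => deriv q r / q r) (Ioi (0:ℝ))

/-- `Q(r) = ∫₀ʳ q(s) ds`. -/
def Qint (q : ℝ → ℝ) (r : ℝ) : ℝ := ∫ s in (0:ℝ)..r, q s

/-- `H = (Q/q)'`. -/
def Hfun (q : ℝ → ℝ) (r : ℝ) : ℝ := deriv (fun t => Qint q t / q t) r

/-- Condition (q3), with `Hinf = H∞`. -/
def CondQ3 (q : ℝ → ℝ) (Hinf : ℝ) : Prop :=
  AntitoneOn (Hfun q) (Ioi (0:ℝ)) ∧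
  (∃ H0 : ℝ, Tendsto (Hfun q) (nhdsWithin 0 (Ioi 0)) (nhds H0) ∧ H0 < 1/2) ∧
  Tendsto (Hfun q) atTop (nhds Hinf) ∧ 0 < Hinf ∧
  MonotoneOn (fun r => q r * (Hfun q r - Hinf)) (Ioi (0:ℝ))

/-- Condition (f3). -/
def CondF3 (c : EReal) (f : ℝ → ℝ) (β Hinf : ℝ) : Prop :=
  ∀ s : ℝ, β < s → (s : EReal) < c →
    (1 - 2 * Hinf) / 2 ≤ deriv (fun t => Fint f t / f t) s

/-- `h(r) = q(r) ∫_r^∞ ds / q(s)`. -/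
def hfun (q : ℝ → ℝ) (r : ℝ) : ℝ := q r * ∫ s in Ioi r, 1 / q s

/-- Condition (q4), with `linf = ℓ∞`. -/
def CondQ4 (q : ℝ → ℝ) (linf : ℝ) : Prop :=
  IntegrableOn (fun r => 1 / q r) (Ioi (1:ℝ)) ∧
  ¬ IntegrableOn (fun r => 1 / q r) (Ioo (0:ℝ) 1) ∧
  (∀ r : ℝ, 0 < r → 0 < deriv (hfun q) r) ∧
  AntitoneOn (deriv (hfun q)) (Ioi (0:ℝ)) ∧
  Tendsto (deriv (hfun q)) atTop (nhds linf) ∧ 0 < linf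

/-- Condition (f4): `s ↦ s f'(s)/f(s)` is decreasing for `s ≥ b`. -/
def CondF4 (c : EReal) (f : ℝ → ℝ) (b : ℝ) : Prop :=
  StrictAntiOn (fun s => s * deriv f s / f s) {s : ℝ | b ≤ s ∧ (s : EReal) < c}

/-- Condition (q5). -/
def CondQ5 (q : ℝ → ℝ) : Prop :=
  StrictMonoOn (fun r => deriv q r * q r) (Ioi (0:ℝ))

/-- Condition (f5). -/
def CondF5 (c : EReal) (f : ℝ → ℝ) (b : ℝ) : Prop :=
  ∀ s : ℝ, b ≤ s → (s : EReal) < c → deriv f s * (s - b) ≤ f s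

/-- Condition (f6). -/
def CondF6 (f : ℝ → ℝ) (β linf : ℝ) : Prop :=
  β * deriv f β / f β ≤ 1 + 2 * linf

/-- `G(r) = (q'/(q h)) ∫₀ʳ h − 1/2`. -/
def Gfun (q : ℝ → ℝ) (r : ℝ) : ℝ :=
  deriv q r / (q r * hfun q r) * (∫ s in (0:ℝ)..r, hfun q s) - 1/2

/-- Condition (q6), with `Gbar = sup_{r>0} G(r)`. -/
def CondQ6 (q : ℝ → ℝ) (Gbar : ℝ) : Prop :=
  (∀ r : ℝ, 0 < r → 0 ≤ Gfun q r) ∧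
  IsLUB (Gfun q '' Ioi (0:ℝ)) Gbar ∧
  MonotoneOn (fun r => Gfun q r * hfun q r / Real.sqrt (∫ s in (0:ℝ)..r, hfun q s))
    (Ioi (0:ℝ))

/-- Condition (q7), with constant `C`. -/
def CondQ7 (q : ℝ → ℝ) (Gbar C : ℝ) : Prop :=
  Gbar ≤ C ∧ C ≤ 1 ∧
  ∃ a : ℝ, a ∈ Ioo (0:ℝ) 1 ∧
    MonotoneOn (fun r => hfun q r ^ (1 - a) * (C - Gfun q r)) (Ioi (0:ℝ))

/-- Condition (f7). -/
def CondF7 (c : EReal) (f : ℝ → ℝ) (β C : ℝ) : Prop :=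
  ∀ s : ℝ, β < s → (s : EReal) < c → C ≤ deriv (fun t => Fint f t / f t) s

/-- `u` has exactly `k` sign changes on `(0,∞)`: there are
`0 = z₀ < z₁ < ⋯ < z_k` such that for `i = 0,…,k` the function `(−1)^i u`
is nonnegative and not identically zero on `[z_i, z_{i+1}]` (with `z_{k+1} = ∞`). -/
def ExactSignChanges (u : ℝ → ℝ) (k : ℕ) : Prop :=
  ∃ z : ℕ → ℝ, z 0 = 0 ∧ (∀ i, i < k → z i < z (i + 1)) ∧
    ∀ i, i ≤ k →
      (∀ r ∈ (if i < k then Icc (z i) (z (i + 1)) else Ici (z i)),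
        0 ≤ (-1 : ℝ) ^ i * u r) ∧
      ∃ r ∈ (if i < k then Icc (z i) (z (i + 1)) else Ici (z i)),
        (-1 : ℝ) ^ i * u r ≠ 0

/-- A first variation `φ` along a solution `u` of (E). -/
structure IsFirstVariation (c : EReal) (f q u φ : ℝ → ℝ) : Prop where
  c1 : ContDiffOn ℝ 1 φ (Ici (0:ℝ))
  init : φ 0 = 1
  dinit : deriv φ 0 = 0
  diff2 : ∀ r : ℝ, 0 < r → u r ≠ 0 → DifferentiableAt ℝ (deriv φ) r
  ode : ∀ r : ℝ, 0 < r → u r ≠ 0 →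
    deriv (deriv φ) r + (deriv q r / q r) * deriv φ r + deriv f (u r) * φ r = 0

/-- The filter of approach to `Z ∈ (0,∞]` from the left. -/
def leftFilter (Z : EReal) : Filter ℝ :=
  if Z = ⊤ then atTop else nhdsWithin Z.toReal (Iio Z.toReal)

/-- `Z₁` for a single solution `w`: the supremum of the radii `r > 0` such that
`w > 0` and `w' < 0 ` on `(0,r)`. -/
def Z1 (w : ℝ → ℝ) : EReal :=
  sSup {z : EReal | ∃ r : ℝ, z = (r : EReal) ∧ 0 < r ∧
    ∀ s : ℝ, 0 < s → s < r → 0 < w s ∧ deriv w s < 0}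

/-- The analytic consequences of (q1)–(q3) for the weight `q`. -/
structure Weight (q : ℝ → ℝ) (Hinf : ℝ) : Prop where
  pos : ∀ r, 0 < r → 0 < q r
  dpos : ∀ r, 0 < r → 0 < deriv q r
  hasDeriv : ∀ r, 0 < r → HasDerivAt q (deriv q r) r
  Qpos : ∀ r, 0 < r → 0 < Qint q r
  hasDerivQ : ∀ r, 0 < r → HasDerivAt (Qint q) (q r) r
  H_eq : ∀ r, 0 < r → Hfun q r = 1 - Qint q r * deriv q r / q r ^ 2
  H_ge : ∀ r, 0 < r → Hinf ≤ Hfun q r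
  Hinf_pos : 0 < Hinf
  H_lt : ∀ r, 0 < r → Hfun q r < 1 / 2
  H_anti : AntitoneOn (Hfun q) (Ioi 0)
  qH_mono : MonotoneOn (fun r => q r * (Hfun q r - Hinf)) (Ioi 0)
  q_mono : MonotoneOn q (Ioi 0)
  quot_anti : StrictAntiOn (fun r => deriv q r / q r) (Ioi 0)
  q_zero : Tendsto q (𝓝[>] 0) (𝓝 0)
  Q_zero : Tendsto (Qint q) (𝓝[>] 0) (𝓝 0)
  Q_le : ∀ r, 0 < r → Qint q r ≤ r * q r

lemma weight_of_conditions {q : ℝ → ℝ} {Hinf : ℝ} (h1 : CondQ1 q) (h2 : CondQ2 q)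
    (h3 : CondQ3 q Hinf) : Weight q Hinf := by
  obtain ⟨hC, hp, hq0, hc0⟩ := h1
  obtain ⟨hHa, ⟨H0, hH0, hH0'⟩, hHi, hHp, hqH⟩ := h3
  have hder : ∀ r, 0 < r → HasDerivAt q (deriv q r) r := fun r hr =>
    ((hC.differentiableOn (by norm_num)).differentiableAt (Ioi_mem_nhds hr)).hasDerivAt
  have hcont : ContinuousOn q (Ici 0) := by
    intro r hr
    rcases eq_or_lt_of_le (show (0:ℝ) ≤ r from hr) with h | h
    · subst h; exact hc0
    · exact (hder r h).continuousAt.continuousWithinAt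
  have hmono : StrictMonoOn q (Ici 0) := by
    apply strictMonoOn_of_deriv_pos (convex_Ici 0) hcont
    intro x hx
    rw [interior_Ici] at hx
    exact (hp x hx).2
  have hint : ∀ r, 0 ≤ r → IntervalIntegrable q volume 0 r := fun r hr => by
    apply ContinuousOn.intervalIntegrable
    rw [uIcc_of_le hr]
    exact hcont.mono Icc_subset_Ici_self
  have hdQ : ∀ r, 0 < r → HasDerivAt (Qint q) (q r) r := fun r hr => by
    apply intervalIntegral.integral_hasDerivAt_right (hint r hr.le) _ (hder r hr).continuousAt
    exact (hcont.mono Ioi_subset_Ici_self).stronglyMeasurableAtFilter isOpen_Ioi r hr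
  have hQp : ∀ r, 0 < r → 0 < Qint q r := fun r hr =>
    intervalIntegral.intervalIntegral_pos_of_pos_on (hint r hr.le) (fun x hx => (hp x hx.1).1) hr
  have hQle : ∀ r, 0 < r → Qint q r ≤ r * q r := fun r hr => by
    have h := intervalIntegral.integral_mono_on hr.le (hint r hr.le)
      (intervalIntegrable_const (c := q r)) (fun x hx => hmono.monotoneOn hx.1 hr.le hx.2)
    simpa [Qint] using h
  have hqz : Tendsto q (𝓝[>] 0) (𝓝 0) := by
    have := hc0.tendsto
    rw [hq0] at this
    exact this.mono_left (nhdsWithin_mono _ Ioi_subset_Ici_self)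
  have hQz : Tendsto (Qint q) (𝓝[>] 0) (𝓝 0) := by
    have hid : Tendsto (fun r : ℝ => r) (𝓝[>] 0) (𝓝 0) :=
      tendsto_nhdsWithin_of_tendsto_nhds tendsto_id
    have h := hid.mul hqz
    rw [mul_zero] at h
    refine squeeze_zero' ?_ ?_ h
    · filter_upwards [self_mem_nhdsWithin] with r hr using (hQp r hr).le
    · filter_upwards [self_mem_nhdsWithin] with r hr using hQle r hr
  refine ⟨fun r hr => (hp r hr).1, fun r hr => (hp r hr).2, hder, hQp, hdQ, ?_, ?_, hHp, ?_,
    hHa, hqH, hmono.monotoneOn.mono Ioi_subset_Ici_self, h2, hqz, hQz, hQle⟩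
  · intro r hr
    have hq := (hp r hr).1
    have h := ((hdQ r hr).fun_div (hder r hr) hq.ne').deriv
    rw [Hfun, h]
    field_simp
  · intro r hr
    refine le_of_tendsto hHi ?_
    filter_upwards [eventually_ge_atTop r] with t ht
    exact hHa hr (hr.trans_le ht) ht
  · intro r hr
    refine lt_of_le_of_lt (ge_of_tendsto hH0 ?_) hH0'
    filter_upwards [Ioo_mem_nhdsGT hr] with t ht
    exact hHa ht.1 hr ht.2.le

/-- The analytic consequences of (f1)–(f3) for `f` on its domain `D` of positive arguments. -/
structure Nonlin (f : ℝ → ℝ) (b β Hinf : ℝ) (D : Set ℝ) : Prop where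
  isOpen : IsOpen D
  pos_of_mem : ∀ s ∈ D, 0 < s
  down : ∀ s ∈ D, ∀ t, 0 < t → t ≤ s → t ∈ D
  b_pos : 0 < b
  b_lt : b < β
  β_mem : β ∈ D
  fpos : ∀ s ∈ D, b < s → 0 < f s
  fneg : ∀ s, 0 ≤ s → s ≤ b → f s ≤ 0
  smooth : ContDiffOn ℝ 1 f D
  hasDerivF : ∀ s ∈ D, HasDerivAt (Fint f) (f s) s
  F_small : ∃ C δ : ℝ, 0 < δ ∧ ∀ s, 0 ≤ s → s ≤ δ → |Fint f s| ≤ C * s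
  Fβ : Fint f β = 0
  quot : ∀ s ∈ D, β < s → (1 - 2 * Hinf) / 2 ≤ deriv (fun t => Fint f t / f t) s

lemma exists_bound_near_zero {f : ℝ → ℝ} {D : Set ℝ} (hD : IsOpen D)
    (hdown : ∀ s ∈ D, ∀ t, 0 < t → t ≤ s → t ∈ D) {d : ℝ} (hd1 : d < 1) (hdD : d ∈ D)
    (hf : ContDiffOn ℝ 1 f D) (hi : IntegrableOn (deriv f) (Ioo (0:ℝ) 1)) :
    ∃ C, 0 ≤ C ∧ ∀ s, 0 < s → s ≤ d → |f s| ≤ C := by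
  refine ⟨|f d| + ∫ t in Ioo (0:ℝ) 1, ‖deriv f t‖, ?_, ?_⟩
  · have : 0 ≤ ∫ t in Ioo (0:ℝ) 1, ‖deriv f t‖ := integral_nonneg fun _ => norm_nonneg _
    positivity
  intro s hs hsd
  have hsub : Set.Ioc s d ⊆ Ioo 0 1 := fun t ht => ⟨hs.trans ht.1, ht.2.trans_lt hd1⟩
  have hftc : ∫ t in s..d, deriv f t = f d - f s := by
    apply intervalIntegral.integral_deriv_eq_sub
    · intro x hx
      rw [uIcc_of_le hsd] at hx
      exact (hf.differentiableOn (by norm_num)).differentiableAt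
        (hD.mem_nhds (hdown d hdD x (hs.trans_le hx.1) hx.2))
    · rw [intervalIntegrable_iff_integrableOn_Ioc_of_le hsd]
      exact hi.mono_set hsub
  have h2 : |∫ t in s..d, deriv f t| ≤ ∫ t in Ioo (0:ℝ) 1, ‖deriv f t‖ := by
    rw [intervalIntegral.integral_of_le hsd, ← Real.norm_eq_abs]
    refine (norm_integral_le_integral_norm _).trans ?_
    exact setIntegral_mono_set hi.norm (ae_of_all _ fun _ => norm_nonneg _)
      (LE.le.eventuallyLE hsub)
  have h3 : f s = f d - ∫ t in s..d, deriv f t := by rw [hftc]; ring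
  rw [h3]
  exact (abs_sub _ _).trans (by linarith)

lemma nonlin_of_conditions {c : EReal} {f : ℝ → ℝ} {b β Hinf : ℝ}
    (h1 : CondF1 c f b β) (h2 : CondF2 c f) (h3 : CondF3 c f β Hinf) :
    Nonlin f b β Hinf {s : ℝ | 0 < s ∧ (s : EReal) < c} := by
  obtain ⟨-, -, hb, hbβ, hβc, hfp, hfn, -, hFβ⟩ := h1
  obtain ⟨hC, hI⟩ := h2
  set D : Set ℝ := {s : ℝ | 0 < s ∧ (s : EReal) < c} with hDdef
  have hDo : IsOpen D := by
    have : D = Ioi 0 ∩ (fun s : ℝ => (s : EReal)) ⁻¹' (Iio c) := rfl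
    rw [this]
    exact isOpen_Ioi.inter (isOpen_Iio.preimage continuous_coe_real_ereal)
  have hdown : ∀ s ∈ D, ∀ t, 0 < t → t ≤ s → t ∈ D := fun s hs t ht hts =>
    ⟨ht, lt_of_le_of_lt (EReal.coe_le_coe_iff.2 hts) hs.2⟩
  have hβD : β ∈ D := ⟨hb.trans hbβ, hβc⟩
  obtain ⟨d, hd0, hd1, hdβ⟩ : ∃ d : ℝ, 0 < d ∧ d < 1 ∧ d ≤ β :=
    ⟨min β (1/2), lt_min (hb.trans hbβ) (by norm_num),
      (min_le_right _ _).trans_lt (by norm_num), min_le_left _ _⟩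
  have hdD := hdown β hβD d hd0 hdβ
  obtain ⟨C, hC0, hCb⟩ := exists_bound_near_zero hDo hdown hd1 hdD hC hI
  have hcont := hC.continuousOn
  have hint : ∀ s ∈ D, IntervalIntegrable f volume 0 s := by
    intro s hs
    have hd' : IntervalIntegrable f volume 0 d := by
      rw [intervalIntegrable_iff_integrableOn_Ioc_of_le hd0.le]
      refine Integrable.of_bound ?_ C ?_
      · exact (hcont.mono fun t ht => hdown d hdD t ht.1 ht.2).aestronglyMeasurable
          measurableSet_Ioc
      · filter_upwards [ae_restrict_mem measurableSet_Ioc] with t ht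
        exact hCb t ht.1 ht.2
    refine hd'.trans (ContinuousOn.intervalIntegrable (hcont.mono ?_))
    intro t ht
    rcases le_total d s with h | h
    · rw [uIcc_of_le h] at ht
      exact hdown s hs t (hd0.trans_le ht.1) ht.2
    · rw [uIcc_of_ge h] at ht
      exact hdown d hdD t (lt_of_lt_of_le hs.1 ht.1) ht.2
  refine ⟨hDo, fun s hs => hs.1, hdown, hb, hbβ, hβD, fun s hs hbs => hfp s hbs hs.2,
    fun s h h' => hfn s ⟨h, h'⟩, hC, ?_, ⟨C, d, hd0, ?_⟩, hFβ, fun s hs h => h3 s h hs.2⟩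
  · intro s hs
    exact intervalIntegral.integral_hasDerivAt_right (hint s hs)
      (hcont.stronglyMeasurableAtFilter hDo s hs) (hcont.continuousAt (hDo.mem_nhds hs))
  · intro s hs hsd
    have h := intervalIntegral.norm_integral_le_of_norm_le_const (a := (0:ℝ)) (b := s) (f := f)
      (C := C) (fun x hx => by
        rw [uIoc_of_le hs] at hx
        exact hCb x hx.1 (hx.2.trans hsd))
    simpa [Fint, abs_of_nonneg hs] using h

namespace Nonlin

variable {f : ℝ → ℝ} {b β Hinf : ℝ} {D : Set ℝ}

lemma continuousAt (hf : Nonlin f b β Hinf D) {s : ℝ} (hs : s ∈ D) : ContinuousAt f s :=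
  hf.smooth.continuousOn.continuousAt (hf.isOpen.mem_nhds hs)

lemma F_tendsto (hf : Nonlin f b β Hinf D) : Tendsto (Fint f) (𝓝[>] 0) (𝓝 0) := by
  obtain ⟨C, δ, hδ, h⟩ := hf.F_small
  have hid : Tendsto (fun r : ℝ => C * r) (𝓝[>] 0) (𝓝 0) := by
    have : Tendsto (fun r : ℝ => C * r) (𝓝 0) (𝓝 (C * 0)) := tendsto_id.const_mul C
    rw [mul_zero] at this
    exact tendsto_nhdsWithin_of_tendsto_nhds this
  refine squeeze_zero_norm' ?_ hid
  filter_upwards [Ioo_mem_nhdsGT hδ] with s hs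
  exact h s hs.1.le hs.2.le

lemma F_nonpos (hf : Nonlin f b β Hinf D) {s : ℝ} (hs : 0 < s) (hsβ : s ≤ β) :
    Fint f s ≤ 0 := by
  have hmem : ∀ t, 0 < t → t ≤ β → t ∈ D := fun t => hf.down β hf.β_mem t
  have hbβ := hf.b_lt
  have hb := hf.b_pos
  rcases le_total s b with hsb | hsb
  · refine ge_of_tendsto hf.F_tendsto ?_
    filter_upwards [Ioo_mem_nhdsGT hs] with t ht
    have : AntitoneOn (Fint f) (Icc t s) := by
      apply antitoneOn_of_deriv_nonpos (convex_Icc _ _)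
      · intro x hx
        exact (hf.hasDerivF x (hmem x (ht.1.trans_le hx.1) (hx.2.trans hsβ))).continuousAt.continuousWithinAt
      · intro x hx
        rw [interior_Icc] at hx
        exact (hf.hasDerivF x (hmem x (ht.1.trans hx.1)
          (hx.2.le.trans hsβ))).differentiableAt.differentiableWithinAt
      · intro x hx
        rw [interior_Icc] at hx
        rw [(hf.hasDerivF x (hmem x (ht.1.trans hx.1) (hx.2.le.trans hsβ))).deriv]
        exact hf.fneg x (ht.1.trans hx.1).le (hx.2.le.trans hsb)
    exact this ⟨le_rfl, ht.2.le⟩ ⟨ht.2.le, le_rfl⟩ ht.2.le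
  · have : MonotoneOn (Fint f) (Icc s β) := by
      apply monotoneOn_of_deriv_nonneg (convex_Icc _ _)
      · intro x hx
        exact (hf.hasDerivF x (hmem x (hs.trans_le hx.1) hx.2)).continuousAt.continuousWithinAt
      · intro x hx
        rw [interior_Icc] at hx
        exact (hf.hasDerivF x (hmem x (hs.trans hx.1)
          hx.2.le)).differentiableAt.differentiableWithinAt
      · intro x hx
        rw [interior_Icc] at hx
        rw [(hf.hasDerivF x (hmem x (hs.trans hx.1) hx.2.le)).deriv]
        exact (hf.fpos x (hmem x (hs.trans hx.1) hx.2.le) (hsb.trans_lt hx.1)).le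
    rw [← hf.Fβ]
    exact this ⟨le_rfl, hsβ⟩ ⟨hsβ, le_rfl⟩ hsβ

end Nonlin

lemma monotoneOn_of_hasDerivAt_nonneg {S : Set ℝ} (hS : Convex ℝ S) {g g' : ℝ → ℝ}
    (h : ∀ x ∈ S, HasDerivAt g (g' x) x) (h0 : ∀ x ∈ interior S, 0 ≤ g' x) : MonotoneOn g S := by
  refine monotoneOn_of_deriv_nonneg hS (fun x hx => (h x hx).continuousAt.continuousWithinAt)
    (fun x hx => (h x (interior_subset hx)).differentiableAt.differentiableWithinAt) ?_
  intro x hx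
  rw [(h x (interior_subset hx)).deriv]
  exact h0 x hx

lemma antitoneOn_of_hasDerivAt_nonpos {S : Set ℝ} (hS : Convex ℝ S) {g g' : ℝ → ℝ}
    (h : ∀ x ∈ S, HasDerivAt g (g' x) x) (h0 : ∀ x ∈ interior S, g' x ≤ 0) : AntitoneOn g S := by
  refine antitoneOn_of_deriv_nonpos hS (fun x hx => (h x hx).continuousAt.continuousWithinAt)
    (fun x hx => (h x (interior_subset hx)).differentiableAt.differentiableWithinAt) ?_
  intro x hx
  rw [(h x (interior_subset hx)).deriv]
  exact h0 x hx

lemma strictMonoOn_of_hasDerivAt_pos {S : Set ℝ} (hS : Convex ℝ S) {g g' : ℝ → ℝ}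
    (h : ∀ x ∈ S, HasDerivAt g (g' x) x) (h0 : ∀ x ∈ interior S, 0 < g' x) :
    StrictMonoOn g S := by
  refine strictMonoOn_of_deriv_pos hS (fun x hx => (h x hx).continuousAt.continuousWithinAt) ?_
  intro x hx
  rw [(h x (interior_subset hx)).deriv]
  exact h0 x hx

lemma strictAntiOn_of_hasDerivAt_neg {S : Set ℝ} (hS : Convex ℝ S) {g g' : ℝ → ℝ}
    (h : ∀ x ∈ S, HasDerivAt g (g' x) x) (h0 : ∀ x ∈ interior S, g' x < 0) :
    StrictAntiOn g S := by
  refine strictAntiOn_of_deriv_neg hS (fun x hx => (h x hx).continuousAt.continuousWithinAt) ?_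
  intro x hx
  rw [(h x (interior_subset hx)).deriv]
  exact h0 x hx

/-- An open property that holds just below `b` and propagates to the left end of every interval
`(s, b)` on which it holds is true on the whole of `(a, b)`. -/
lemma leftward_induction {a b : ℝ} (hab : a < b) {O : ℝ → Prop} (h0 : ∀ᶠ s in 𝓝[<] b, O s)
    (hopen : ∀ s ∈ Ioo a b, O s → ∀ᶠ t in 𝓝[<] s, O t)
    (hstep : ∀ s ∈ Ioo a b, (∀ t ∈ Ioo s b, O t) → O s) : ∀ s ∈ Ioo a b, O s := by
  set S : Set ℝ := {s | s ∈ Ioo a b ∧ ∀ t ∈ Ioo s b, O t} with hS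
  have hbdd : BddBelow S := ⟨a, fun s hs => hs.1.1.le⟩
  obtain ⟨l, hl, hlO⟩ := (mem_nhdsLT_iff_exists_Ioo_subset' hab).1 h0
  have hne : S.Nonempty := by
    refine ⟨max l ((a + b) / 2), ⟨?_, ?_⟩, fun t ht => hlO ⟨(le_max_left _ _).trans_lt ht.1, ht.2⟩⟩
    · exact lt_of_lt_of_le (by linarith) (le_max_right _ _)
    · exact max_lt hl (by linarith)
  set m := sInf S with hm
  have hall : ∀ t ∈ Ioo m b, O t := by
    intro t ht
    obtain ⟨s, hs, hst⟩ := exists_lt_of_csInf_lt hne ht.1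
    exact hs.2 t ⟨hst, ht.2⟩
  have hma : a ≤ m := le_csInf hne fun s hs => hs.1.1.le
  have hmb : m < b := by
    obtain ⟨s, hs⟩ := hne
    exact (csInf_le hbdd hs).trans_lt hs.1.2
  rcases hma.eq_or_lt with h | h
  · rw [h]; exact hall
  · exfalso
    have hOm := hstep m ⟨h, hmb⟩ hall
    obtain ⟨l', hl', hl'O⟩ :=
      (mem_nhdsLT_iff_exists_Ioo_subset' h).1 (hopen m ⟨h, hmb⟩ hOm)
    obtain ⟨s, hs1, hs2⟩ := exists_between (max_lt hl' h)
    have hsS : s ∈ S := by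
      refine ⟨⟨(le_max_right _ _).trans_lt hs1, hs2.trans hmb⟩, fun t ht => ?_⟩
      rcases lt_trichotomy t m with h' | h' | h'
      · exact hl'O ⟨(le_max_left _ _).trans_lt (hs1.trans ht.1), h'⟩
      · rw [h']; exact hOm
      · exact hall t ⟨h', ht.2⟩
    exact absurd (csInf_le hbdd hsS) (not_le.2 hs2)

/-- A decreasing positive solution described by its inverse function `r` and by its slope
`y(s) = |u'(r(s))|`, as functions of the height `s ∈ (0, α)`. -/
structure Profile (f q : ℝ → ℝ) (β : ℝ) (D : Set ℝ) (α : ℝ) (r y : ℝ → ℝ) : Prop where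
  α_mem : α ∈ D
  β_lt : β < α
  rpos : ∀ s ∈ Ioo 0 α, 0 < r s
  ypos : ∀ s ∈ Ioo 0 α, 0 < y s
  hasDeriv_r : ∀ s ∈ Ioo 0 α, HasDerivAt r (-(1 / y s)) s
  hasDeriv_y : ∀ s ∈ Ioo 0 α, HasDerivAt y (deriv q (r s) / q (r s) - f s / y s) s
  r_top : Tendsto r (𝓝[<] α) (𝓝[>] 0)
  y_top : Tendsto y (𝓝[<] α) (𝓝 0)
  y_zero : Tendsto y (𝓝[>] 0) (𝓝 0)

lemma Weight.hasDerivAt_ratio {q : ℝ → ℝ} {Hinf : ℝ} (hq : Weight q Hinf) {r : ℝ} (hr : 0 < r) :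
    HasDerivAt (fun r => Qint q r / q r) (Hfun q r) r := by
  have hq0 := hq.pos r hr
  refine HasDerivAt.congr_deriv ((hq.hasDerivQ r hr).fun_div (hq.hasDeriv r hr) hq0.ne') ?_
  rw [hq.H_eq r hr]
  field_simp

/-- The ratio `Q/q` is strictly increasing. -/
lemma Weight.ratio_strictMono {q : ℝ → ℝ} {Hinf : ℝ} (hq : Weight q Hinf) :
    StrictMonoOn (fun r => Qint q r / q r) (Ioi 0) := by
  refine strictMonoOn_of_hasDerivAt_pos (convex_Ioi 0) (g' := Hfun q)
    (fun r hr => hq.hasDerivAt_ratio hr) ?_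
  intro r hr
  rw [interior_Ioi] at hr
  exact hq.Hinf_pos.trans_le (hq.H_ge r hr)

lemma Weight.ratio_pos {q : ℝ → ℝ} {Hinf : ℝ} (hq : Weight q Hinf) {r : ℝ} (hr : 0 < r) :
    0 < Qint q r / q r := div_pos (hq.Qpos r hr) (hq.pos r hr)

lemma Weight.ratio_mul {q : ℝ → ℝ} {Hinf : ℝ} (hq : Weight q Hinf) {r : ℝ} (hr : 0 < r) :
    Qint q r / q r * (deriv q r / q r) = 1 - Hfun q r := by
  rw [hq.H_eq r hr]; have := hq.pos r hr; field_simp; ring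

lemma Weight.Q_div_sq_strictAnti {q : ℝ → ℝ} {Hinf : ℝ} (hq : Weight q Hinf) :
    StrictAntiOn (fun r => Qint q r / q r ^ 2) (Ioi 0) := by
  refine strictAntiOn_of_hasDerivAt_neg (convex_Ioi 0)
    (g' := fun r => (2 * Hfun q r - 1) / q r) ?_ ?_
  · intro r hr
    have hq0 := hq.pos r hr
    refine HasDerivAt.congr_deriv ((hq.hasDerivQ r hr).fun_div ((hq.hasDeriv r hr).fun_pow 2) (by positivity)) ?_
    rw [hq.H_eq r hr]
    field_simp
    ring
  · intro r hr
    rw [interior_Ioi] at hr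
    have h1 := hq.H_lt r hr
    exact div_neg_of_neg_of_pos (by linarith) (hq.pos r hr)

namespace Profile

variable {f q : ℝ → ℝ} {b β Hinf : ℝ} {D : Set ℝ} {α α₁ α₂ : ℝ} {r y r₁ y₁ r₂ y₂ : ℝ → ℝ}

lemma mem (hf : Nonlin f b β Hinf D) (p : Profile f q β D α r y) {s : ℝ} (hs : s ∈ Ioo 0 α) :
    s ∈ D := hf.down α p.α_mem s hs.1 hs.2.le

lemma y_mono (hf : Nonlin f b β Hinf D) (hq : Weight q Hinf) (p : Profile f q β D α r y) :
    MonotoneOn y (Ioc 0 b) := by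
  have hsub : ∀ s ∈ Ioc 0 b, s ∈ Ioo 0 α := fun s hs =>
    ⟨hs.1, (hs.2.trans_lt hf.b_lt).trans p.β_lt⟩
  refine monotoneOn_of_hasDerivAt_nonneg (convex_Ioc 0 b)
    (fun s hs => p.hasDeriv_y s (hsub s hs)) ?_
  intro s hs
  have hs := interior_subset hs
  have h1 := p.rpos s (hsub s hs)
  have h2 := p.ypos s (hsub s hs)
  have h3 := div_pos (hq.dpos _ h1) (hq.pos _ h1)
  have h4 := div_nonpos_of_nonpos_of_nonneg (hf.fneg s hs.1.le hs.2) h2.le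
  linarith

lemma r_mul_y_zero (hf : Nonlin f b β Hinf D) (hq : Weight q Hinf)
    (p : Profile f q β D α r y) : Tendsto (fun s => r s * y s) (𝓝[>] 0) (𝓝 0) := by
  have hsub : ∀ s ∈ Ioc 0 b, s ∈ Ioo 0 α := fun s hs =>
    ⟨hs.1, (hs.2.trans_lt hf.b_lt).trans p.β_lt⟩
  have key : ∀ s s' : ℝ, 0 < s → s < s' → s' ≤ b → r s * y s ≤ s' + r s' * y s := by
    intro s s' hs hss hs'
    have hmono : MonotoneOn (fun t => r t + t / y s) (Icc s s') := by
      have hd : ∀ t ∈ Icc s s',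
          HasDerivAt (fun t => r t + t / y s) (-(1 / y t) + 1 / y s) t := fun t ht =>
        (p.hasDeriv_r t (hsub t ⟨hs.trans_le ht.1, ht.2.trans hs'⟩)).add
          ((hasDerivAt_id t).div_const _)
      refine monotoneOn_of_hasDerivAt_nonneg (convex_Icc s s') hd ?_
      intro t ht
      have ht := interior_subset ht
      have hy := p.y_mono hf hq ⟨hs, hss.le.trans hs'⟩ ⟨hs.trans_le ht.1, ht.2.trans hs'⟩ ht.1
      have := one_div_le_one_div_of_le (p.ypos s (hsub s ⟨hs, hss.le.trans hs'⟩)) hy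
      linarith
    have h := hmono ⟨le_rfl, hss.le⟩ ⟨hss.le, le_rfl⟩ hss.le
    have hy := p.ypos s (hsub s ⟨hs, hss.le.trans hs'⟩)
    have h2 := mul_le_mul_of_nonneg_right h hy.le
    have e1 : (r s + s / y s) * y s = r s * y s + s := by field_simp
    have e2 : (r s' + s' / y s) * y s = r s' * y s + s' := by field_simp
    simp only [e1, e2] at h2
    linarith
  rw [Metric.tendsto_nhds]
  intro ε hε
  set s' := min b (ε / 2) with hs'
  have hs'0 : 0 < s' := lt_min hf.b_pos (by linarith)
  have hlim : Tendsto (fun s => r s' * y s) (𝓝[>] 0) (𝓝 0) := by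
    simpa using p.y_zero.const_mul (r s')
  filter_upwards [Ioo_mem_nhdsGT hs'0, hlim.eventually (gt_mem_nhds (half_pos hε))] with s hs h
  have hb' : s' ≤ b := min_le_left _ _
  have hm := hsub s ⟨hs.1, hs.2.le.trans hb'⟩
  have := key s s' hs.1 hs.2 hb'
  have hp := mul_pos (p.rpos s hm) (p.ypos s hm)
  rw [Real.dist_eq, sub_zero, abs_of_pos hp]
  have : s' ≤ ε / 2 := min_le_right _ _
  linarith

lemma gap_lt (p₁ : Profile f q β D α₁ r₁ y₁) (p₂ : Profile f q β D α₂ r₂ y₂) {s t : ℝ}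
    (hs : 0 < s) (hst : s < t) (ht₁ : t < α₁) (ht₂ : t < α₂) (h : ∀ x ∈ Ioo s t, y₁ x < y₂ x) :
    r₁ t - r₂ t < r₁ s - r₂ s := by
  have hm₁ : ∀ x ∈ Icc s t, x ∈ Ioo 0 α₁ := fun x hx => ⟨hs.trans_le hx.1, hx.2.trans_lt ht₁⟩
  have hm₂ : ∀ x ∈ Icc s t, x ∈ Ioo 0 α₂ := fun x hx => ⟨hs.trans_le hx.1, hx.2.trans_lt ht₂⟩
  have : StrictAntiOn (fun x => r₁ x - r₂ x) (Icc s t) := by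
    refine strictAntiOn_of_hasDerivAt_neg (convex_Icc s t)
      (fun x hx => (p₁.hasDeriv_r x (hm₁ x hx)).sub (p₂.hasDeriv_r x (hm₂ x hx))) ?_
    intro x hx
    rw [interior_Icc] at hx
    have := one_div_lt_one_div_of_lt (p₁.ypos x (hm₁ x (Ioo_subset_Icc_self hx))) (h x hx)
    linarith
  exact this ⟨le_rfl, hst.le⟩ ⟨hst.le, le_rfl⟩ hst

lemma continuousAt_r (p : Profile f q β D α r y) {s : ℝ} (hs : s ∈ Ioo 0 α) : ContinuousAt r s :=
  (p.hasDeriv_r s hs).continuousAt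

lemma continuousAt_y (p : Profile f q β D α r y) {s : ℝ} (hs : s ∈ Ioo 0 α) : ContinuousAt y s :=
  (p.hasDeriv_y s hs).continuousAt

lemma hasDerivAt_energy (hf : Nonlin f b β Hinf D) (p : Profile f q β D α r y) {s : ℝ}
    (hs : s ∈ Ioo 0 α) : HasDerivAt (fun s => y s ^ 2 + 2 * Fint f s)
      (2 * y s * (deriv q (r s) / q (r s))) s := by
  have hy := p.ypos s hs
  refine HasDerivAt.congr_deriv (((p.hasDeriv_y s hs).fun_pow 2).add ((hf.hasDerivF s (p.mem hf hs)).const_mul 2)) ?_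
  field_simp
  ring

lemma energy_pos (hf : Nonlin f b β Hinf D) (hq : Weight q Hinf) (p : Profile f q β D α r y)
    {s : ℝ} (hs : s ∈ Ioo 0 α) : 0 < y s ^ 2 + 2 * Fint f s := by
  have hmono : StrictMonoOn (fun s => y s ^ 2 + 2 * Fint f s) (Ioo 0 α) := by
    refine strictMonoOn_of_hasDerivAt_pos (convex_Ioo 0 α)
      (fun s hs => p.hasDerivAt_energy hf hs) ?_
    intro x hx
    have hx := interior_subset hx
    have h1 := p.rpos x hx
    exact mul_pos (mul_pos two_pos (p.ypos x hx)) (div_pos (hq.dpos _ h1) (hq.pos _ h1))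
  have hlim : Tendsto (fun s => y s ^ 2 + 2 * Fint f s) (𝓝[>] 0) (𝓝 0) := by
    simpa using (p.y_zero.pow 2).add (hf.F_tendsto.const_mul 2)
  have hs2 : s / 2 ∈ Ioo 0 α := ⟨by linarith [hs.1], by linarith [hs.1, hs.2]⟩
  have h1 : 0 ≤ y (s / 2) ^ 2 + 2 * Fint f (s / 2) := by
    refine le_of_tendsto hlim ?_
    filter_upwards [Ioo_mem_nhdsGT hs2.1] with t ht
    exact (hmono ⟨ht.1, ht.2.trans hs2.2⟩ hs2 ht.2).le
  exact h1.trans_lt (hmono hs2 hs (by linarith [hs.1]))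

/-- The functional `T = (Q/q) √(u'² + 2F(u))`. -/
def T (f q r y : ℝ → ℝ) (s : ℝ) : ℝ :=
  Qint q (r s) / q (r s) * √(y s ^ 2 + 2 * Fint f s)

lemma hasDerivAt_T (hf : Nonlin f b β Hinf D) (hq : Weight q Hinf) (p : Profile f q β D α r y)
    {s : ℝ} (hs : s ∈ Ioo 0 α) :
    HasDerivAt (T f q r y) ((1 - Hfun q (r s)) * (y s / √(y s ^ 2 + 2 * Fint f s)) -
      Hfun q (r s) * (√(y s ^ 2 + 2 * Fint f s) / y s)) s := by
  have hE := p.energy_pos hf hq hs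
  have hr := p.rpos s hs
  have hy := p.ypos s hs
  have h1 := (hq.hasDerivAt_ratio hr).comp s (p.hasDeriv_r s hs)
  have h2 := (p.hasDerivAt_energy hf hs).sqrt hE.ne'
  refine HasDerivAt.congr_deriv (h1.mul h2) ?_
  have hs' := Real.sqrt_pos.2 hE
  rw [← hq.ratio_mul hr]
  simp only [Function.comp]
  field_simp
  ring

lemma slope_lt_of_T_lt (hq : Weight q Hinf) (p₁ : Profile f q β D α₁ r₁ y₁)
    (p₂ : Profile f q β D α₂ r₂ y₂) {s : ℝ} (hs₁ : s ∈ Ioo 0 α₁) (hs₂ : s ∈ Ioo 0 α₂)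
    (hr : r₂ s ≤ r₁ s) (hT : T f q r₁ y₁ s < T f q r₂ y₂ s) : y₁ s < y₂ s := by
  by_contra! hcon
  refine absurd hT (not_lt.2 ?_)
  have h1 := hq.ratio_strictMono.monotoneOn (p₂.rpos s hs₂) (p₁.rpos s hs₁) hr
  have h2 : √(y₂ s ^ 2 + 2 * Fint f s) ≤ √(y₁ s ^ 2 + 2 * Fint f s) := by
    apply Real.sqrt_le_sqrt
    have := p₂.ypos s hs₂
    gcongr
  exact mul_le_mul h1 h2 (Real.sqrt_nonneg _) (hq.ratio_pos (p₁.rpos s hs₁)).le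

lemma T_deriv_le (hf : Nonlin f b β Hinf D) (hq : Weight q Hinf) (p₁ : Profile f q β D α₁ r₁ y₁)
    (p₂ : Profile f q β D α₂ r₂ y₂) {s : ℝ} (hs₁ : s ∈ Ioo 0 α₁) (hs₂ : s ∈ Ioo 0 α₂)
    (hsβ : s ≤ β) (hr : r₂ s ≤ r₁ s) (hy : y₁ s ≤ y₂ s) :
    (1 - Hfun q (r₂ s)) * (y₂ s / √(y₂ s ^ 2 + 2 * Fint f s)) -
      Hfun q (r₂ s) * (√(y₂ s ^ 2 + 2 * Fint f s) / y₂ s) ≤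
    (1 - Hfun q (r₁ s)) * (y₁ s / √(y₁ s ^ 2 + 2 * Fint f s)) -
      Hfun q (r₁ s) * (√(y₁ s ^ 2 + 2 * Fint f s) / y₁ s) := by
  have hE₁ := p₁.energy_pos hf hq hs₁
  have hE₂ := p₂.energy_pos hf hq hs₂
  have hr₁ := p₁.rpos s hs₁
  have hr₂ := p₂.rpos s hs₂
  have hy₁ := p₁.ypos s hs₁
  have hy₂ := p₂.ypos s hs₂
  have hF := hf.F_nonpos hs₁.1 hsβ
  have hH := hq.H_anti hr₂ hr₁ hr
  have hH2 := hq.H_lt _ hr₂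
  have hH1 := hq.Hinf_pos.trans_le (hq.H_ge _ hr₁)
  set e₁ := √(y₁ s ^ 2 + 2 * Fint f s) with he₁
  set e₂ := √(y₂ s ^ 2 + 2 * Fint f s) with he₂
  have he₁0 : 0 < e₁ := Real.sqrt_pos.2 hE₁
  have he₂0 : 0 < e₂ := Real.sqrt_pos.2 hE₂
  have hcross : e₁ * y₂ s ≤ e₂ * y₁ s := by
    refine abs_le_of_sq_le_sq' ?_ (by positivity) |>.2
    rw [mul_pow, mul_pow, he₁, he₂, Real.sq_sqrt hE₁.le, Real.sq_sqrt hE₂.le]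
    have : y₁ s ^ 2 ≤ y₂ s ^ 2 := by gcongr
    nlinarith
  have h1 : y₂ s / e₂ ≤ y₁ s / e₁ := by
    rw [div_le_div_iff₀ he₂0 he₁0]; linarith
  have h2 : e₁ / y₁ s ≤ e₂ / y₂ s := by
    rw [div_le_div_iff₀ hy₁ hy₂]; linarith
  have p1 : 0 < y₁ s / e₁ := by positivity
  have p2 : 0 < e₁ / y₁ s := by positivity
  nlinarith [mul_le_mul_of_nonneg_left h1 (show 0 ≤ 1 - Hfun q (r₂ s) by linarith),
    mul_le_mul_of_nonneg_left h2 (show 0 ≤ Hfun q (r₂ s) by linarith),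
    mul_le_mul_of_nonneg_right hH p1.le, mul_le_mul_of_nonneg_right hH p2.le]

/-- Below the height `β`, the graph lying further to the right cannot have the smaller `T`. -/
lemma not_T_lt (hf : Nonlin f b β Hinf D) (hq : Weight q Hinf)
    (p₁ : Profile f q β D α₁ r₁ y₁) (p₂ : Profile f q β D α₂ r₂ y₂) {s₀ : ℝ} (hs₀ : 0 < s₀)
    (hs₀β : s₀ ≤ β) (hr : r₂ s₀ ≤ r₁ s₀) (hT : T f q r₁ y₁ s₀ < T f q r₂ y₂ s₀) : False := by
  have hm₁ : ∀ x ∈ Ioc 0 s₀, x ∈ Ioo 0 α₁ := fun x hx =>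
    ⟨hx.1, (hx.2.trans hs₀β).trans_lt p₁.β_lt⟩
  have hm₂ : ∀ x ∈ Ioc 0 s₀, x ∈ Ioo 0 α₂ := fun x hx =>
    ⟨hx.1, (hx.2.trans hs₀β).trans_lt p₂.β_lt⟩
  have hs₀m : s₀ ∈ Ioc 0 s₀ := ⟨hs₀, le_rfl⟩
  have hTc : ∀ s ∈ Ioc 0 s₀, T f q r₁ y₁ s < T f q r₂ y₂ s →
      ∀ᶠ t in 𝓝[<] s, T f q r₁ y₁ t < T f q r₂ y₂ t := fun s hs h =>
    ((p₁.hasDerivAt_T hf hq (hm₁ s hs)).continuousAt.eventually_lt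
      (p₂.hasDerivAt_T hf hq (hm₂ s hs)).continuousAt h).filter_mono nhdsWithin_le_nhds
  have hanti : ∀ s, 0 < s → (∀ t ∈ Ioo s s₀, r₂ t < r₁ t ∧ T f q r₁ y₁ t < T f q r₂ y₂ t) →
      s < s₀ → T f q r₂ y₂ s₀ - T f q r₁ y₁ s₀ ≤ T f q r₂ y₂ s - T f q r₁ y₁ s := by
    intro s hs hO hss
    have hsub : ∀ x ∈ Icc s s₀, x ∈ Ioc 0 s₀ := fun x hx => ⟨hs.trans_le hx.1, hx.2⟩
    have : AntitoneOn (fun x => T f q r₂ y₂ x - T f q r₁ y₁ x) (Icc s s₀) := by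
      refine antitoneOn_of_hasDerivAt_nonpos (convex_Icc _ _)
        (fun x hx => (p₂.hasDerivAt_T hf hq (hm₂ x (hsub x hx))).sub
          (p₁.hasDerivAt_T hf hq (hm₁ x (hsub x hx)))) ?_
      intro x hx
      rw [interior_Icc] at hx
      have hx' := hsub x (Ioo_subset_Icc_self hx)
      have h1 := hO x hx
      have h2 := slope_lt_of_T_lt hq p₁ p₂ (hm₁ x hx') (hm₂ x hx') h1.1.le h1.2
      exact sub_nonpos.2 (T_deriv_le hf hq p₁ p₂ (hm₁ x hx') (hm₂ x hx')
        (hx'.2.trans hs₀β) h1.1.le h2.le)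
    exact this ⟨le_rfl, hss.le⟩ ⟨hss.le, le_rfl⟩ hss.le
  have hall : ∀ s ∈ Ioo 0 s₀, r₂ s < r₁ s ∧ T f q r₁ y₁ s < T f q r₂ y₂ s := by
    refine leftward_induction hs₀ ?_ ?_ ?_
    · have hy := slope_lt_of_T_lt hq p₁ p₂ (hm₁ _ hs₀m) (hm₂ _ hs₀m) hr hT
      have hyc : ∀ᶠ t in 𝓝[<] s₀, y₁ t < y₂ t :=
        ((p₁.continuousAt_y (hm₁ _ hs₀m)).eventually_lt
          (p₂.continuousAt_y (hm₂ _ hs₀m)) hy).filter_mono nhdsWithin_le_nhds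
      obtain ⟨l, hl, hlO⟩ := (mem_nhdsLT_iff_exists_Ioo_subset' hs₀).1 hyc
      filter_upwards [hTc s₀ hs₀m hT, Ioo_mem_nhdsLT (max_lt hl hs₀)] with t ht ht'
      refine ⟨?_, ht⟩
      have := gap_lt p₁ p₂ ((le_max_right _ _).trans_lt ht'.1) ht'.2 (hm₁ _ hs₀m).2
        (hm₂ _ hs₀m).2 (fun x hx => hlO ⟨(le_max_left _ _).trans_lt (ht'.1.trans hx.1), hx.2⟩)
      linarith
    · intro s hs hO
      have hs' : s ∈ Ioc 0 s₀ := ⟨hs.1, hs.2.le⟩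
      refine Filter.Eventually.and ?_ (hTc s hs' hO.2)
      exact ((p₂.continuousAt_r (hm₂ s hs')).eventually_lt
        (p₁.continuousAt_r (hm₁ s hs')) hO.1).filter_mono nhdsWithin_le_nhds
    · intro s hs hO
      have h1 := hanti s hs.1 hO hs.2
      have h2 := gap_lt p₁ p₂ hs.1 hs.2 (hm₁ _ hs₀m).2 (hm₂ _ hs₀m).2 (fun x hx => by
        have hx' : x ∈ Ioc 0 s₀ := ⟨hs.1.trans hx.1, hx.2.le⟩
        exact slope_lt_of_T_lt hq p₁ p₂ (hm₁ x hx') (hm₂ x hx') (hO x hx).1.le (hO x hx).2)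
      constructor <;> linarith
  have hlim := (p₂.r_mul_y_zero hf hq).eventually (gt_mem_nhds (sub_pos.2 hT))
  obtain ⟨s, hs1, hs2⟩ := (hlim.and (Ioo_mem_nhdsGT hs₀)).exists
  have hs' : s ∈ Ioc 0 s₀ := ⟨hs2.1, hs2.2.le⟩
  have h1 := hanti s hs2.1 (fun t ht => hall t ⟨hs2.1.trans ht.1, ht.2⟩) hs2.2
  have hr₂ := p₂.rpos s (hm₂ s hs')
  have hy₂ := p₂.ypos s (hm₂ s hs')
  have h2 : T f q r₂ y₂ s ≤ r₂ s * y₂ s := by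
    refine mul_le_mul ?_ ?_ (Real.sqrt_nonneg _) hr₂.le
    · rw [div_le_iff₀ (hq.pos _ hr₂)]; exact hq.Q_le _ hr₂
    · refine Real.sqrt_le_iff.2 ⟨hy₂.le, ?_⟩
      have := hf.F_nonpos hs2.1 (hs2.2.le.trans hs₀β)
      linarith
  have h3 : 0 ≤ T f q r₁ y₁ s :=
    mul_nonneg (hq.ratio_pos (p₁.rpos s (hm₁ s hs'))).le (Real.sqrt_nonneg _)
  linarith

end Profile

lemma Weight.q_strictMono {q : ℝ → ℝ} {Hinf : ℝ} (hq : Weight q Hinf) :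
    StrictMonoOn q (Ioi 0) := by
  refine strictMonoOn_of_hasDerivAt_pos (convex_Ioi 0) (fun r hr => hq.hasDeriv r hr) ?_
  intro r hr
  rw [interior_Ioi] at hr
  exact hq.dpos r hr

/-- Weak inequalities pass to the left end of an interval. -/
lemma le_of_forall_Ioo_le {g h : ℝ → ℝ} {s t : ℝ} (hst : s < t) (hg : ContinuousAt g s)
    (hh : ContinuousAt h s) (H : ∀ x ∈ Ioo s t, g x ≤ h x) : g s ≤ h s := by
  refine le_of_tendsto_of_tendsto (hg.tendsto.mono_left nhdsWithin_le_nhds)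
    (hh.tendsto.mono_left nhdsWithin_le_nhds) (b := 𝓝[>] s) ?_
  filter_upwards [Ioo_mem_nhdsGT hst] with x hx using H x hx

namespace Profile

variable {f q : ℝ → ℝ} {b β Hinf : ℝ} {D : Set ℝ} {α α₁ α₂ : ℝ} {r y r₁ y₁ r₂ y₂ : ℝ → ℝ}

/-- The flux `q |u'|`. -/
def M (q r y : ℝ → ℝ) (s : ℝ) : ℝ := q (r s) * y s

/-- The Pohozaev-type functional. -/
def P (f q r y : ℝ → ℝ) (s : ℝ) : ℝ :=
  Qint q (r s) * (y s ^ 2 + 2 * Fint f s) - 2 * (M q r y s * (Fint f s / f s))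

/-- The coefficient in the derivative of `P`. -/
def K (f q r : ℝ → ℝ) (s : ℝ) : ℝ :=
  2 * Hfun q (r s) - 1 + 2 * deriv (fun t => Fint f t / f t) s

lemma M_pos (hq : Weight q Hinf) (p : Profile f q β D α r y) {s : ℝ} (hs : s ∈ Ioo 0 α) :
    0 < M q r y s := mul_pos (hq.pos _ (p.rpos s hs)) (p.ypos s hs)

lemma hasDerivAt_M (hq : Weight q Hinf) (p : Profile f q β D α r y) {s : ℝ}
    (hs : s ∈ Ioo 0 α) : HasDerivAt (M q r y) (-(M q r y s * (f s / y s ^ 2))) s := by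
  have hr := p.rpos s hs
  have hy := p.ypos s hs
  have hq0 := hq.pos _ hr
  refine HasDerivAt.congr_deriv
    (((hq.hasDeriv _ hr).comp s (p.hasDeriv_r s hs)).mul (p.hasDeriv_y s hs)) ?_
  simp only [M, Function.comp]
  field_simp
  ring

lemma hasDerivAt_P (hf : Nonlin f b β Hinf D) (hq : Weight q Hinf) (p : Profile f q β D α r y)
    {s : ℝ} (hs : s ∈ Ioo 0 α) (hbs : b < s) :
    HasDerivAt (P f q r y) (-(M q r y s * K f q r s)) s := by
  have hr := p.rpos s hs
  have hy := p.ypos s hs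
  have hq0 := hq.pos _ hr
  have hfs := hf.fpos s (p.mem hf hs) hbs
  have hfd : DifferentiableAt ℝ f s :=
    (hf.smooth.differentiableOn (by norm_num)).differentiableAt
      (hf.isOpen.mem_nhds (p.mem hf hs))
  have hG : HasDerivAt (fun t => Fint f t / f t) (deriv (fun t => Fint f t / f t) s) s :=
    ((hf.hasDerivF s (p.mem hf hs)).differentiableAt.fun_div hfd hfs.ne').hasDerivAt
  have h1 := ((hq.hasDerivQ _ hr).comp s (p.hasDeriv_r s hs)).mul (p.hasDerivAt_energy hf hs)
  have h2 := ((p.hasDerivAt_M hq hs).mul hG).const_mul 2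
  refine HasDerivAt.congr_deriv (h1.sub h2) ?_
  simp only [K, M, Function.comp, hq.H_eq _ hr]
  field_simp
  ring

lemma K_nonneg (hf : Nonlin f b β Hinf D) (hq : Weight q Hinf) (p : Profile f q β D α r y)
    {s : ℝ} (hs : s ∈ Ioo 0 α) (hβs : β < s) : 0 ≤ K f q r s := by
  have h1 := hf.quot s (p.mem hf hs) hβs
  have h2 := hq.H_ge _ (p.rpos s hs)
  unfold K
  linarith

lemma K_le_of_r_le (hq : Weight q Hinf) (p₁ : Profile f q β D α₁ r₁ y₁)
    (p₂ : Profile f q β D α₂ r₂ y₂) {s : ℝ} (hs₁ : s ∈ Ioo 0 α₁) (hs₂ : s ∈ Ioo 0 α₂)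
    (hr : r₂ s ≤ r₁ s) : K f q r₁ s ≤ K f q r₂ s := by
  have := hq.H_anti (p₂.rpos s hs₂) (p₁.rpos s hs₁) hr
  unfold K
  linarith

lemma MK_le (hf : Nonlin f b β Hinf D) (hq : Weight q Hinf) (p₁ : Profile f q β D α₁ r₁ y₁)
    (p₂ : Profile f q β D α₂ r₂ y₂) {s : ℝ} (hs₁ : s ∈ Ioo 0 α₁) (hs₂ : s ∈ Ioo 0 α₂)
    (hβs : β < s) (hr : r₁ s ≤ r₂ s) (hy : y₁ s ≤ y₂ s) :
    M q r₁ y₁ s * K f q r₁ s ≤ M q r₂ y₂ s * K f q r₂ s := by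
  have hr₁ := p₁.rpos s hs₁
  have hr₂ := p₂.rpos s hs₂
  have h1 := hq.qH_mono hr₁ hr₂ hr
  have h2 := hq.q_mono hr₁ hr₂ hr
  have h3 := hf.quot s (p₁.mem hf hs₁) hβs
  have hqK : q (r₁ s) * K f q r₁ s ≤ q (r₂ s) * K f q r₂ s := by
    simp only [K] at h1 ⊢
    nlinarith [mul_le_mul_of_nonneg_right h2
      (show 0 ≤ 2 * Hinf - 1 + 2 * deriv (fun t => Fint f t / f t) s by linarith)]
  have hK : 0 ≤ q (r₁ s) * K f q r₁ s :=
    mul_nonneg (hq.pos _ hr₁).le (p₁.K_nonneg hf hq hs₁ hβs)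
  calc M q r₁ y₁ s * K f q r₁ s = (q (r₁ s) * K f q r₁ s) * y₁ s := by unfold M; ring
    _ ≤ (q (r₂ s) * K f q r₂ s) * y₂ s :=
        mul_le_mul hqK hy (p₁.ypos s hs₁).le (hK.trans hqK)
    _ = M q r₂ y₂ s * K f q r₂ s := by unfold M; ring

lemma P_top (hf : Nonlin f b β Hinf D) (hq : Weight q Hinf) (p : Profile f q β D α r y) :
    Tendsto (P f q r y) (𝓝[<] α) (𝓝 0) := by
  have hfα := hf.fpos α p.α_mem (hf.b_lt.trans p.β_lt)
  have hF : Tendsto (Fint f) (𝓝[<] α) (𝓝 (Fint f α)) :=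
    (hf.hasDerivF α p.α_mem).continuousAt.tendsto.mono_left nhdsWithin_le_nhds
  have hfl : Tendsto f (𝓝[<] α) (𝓝 (f α)) :=
    (hf.continuousAt p.α_mem).tendsto.mono_left nhdsWithin_le_nhds
  have h1 := (hq.Q_zero.comp p.r_top).mul ((p.y_top.pow 2).add (hF.const_mul 2))
  have h2 := (((hq.q_zero.comp p.r_top).mul p.y_top).mul (hF.div hfl hfα.ne')).const_mul 2
  have := h1.sub h2
  simp only [zero_mul, mul_zero, sub_zero] at this
  exact this

lemma P_nonneg (hf : Nonlin f b β Hinf D) (hq : Weight q Hinf) (p : Profile f q β D α r y)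
    {s : ℝ} (hs : s ∈ Ico β α) : 0 ≤ P f q r y s := by
  have hm : ∀ x ∈ Ico β α, x ∈ Ioo 0 α := fun x hx =>
    ⟨(hf.b_pos.trans hf.b_lt).trans_le hx.1, hx.2⟩
  have hanti : AntitoneOn (P f q r y) (Ico β α) := by
    refine antitoneOn_of_hasDerivAt_nonpos (convex_Ico _ _)
      (fun x hx => p.hasDerivAt_P hf hq (hm x hx) (hf.b_lt.trans_le hx.1)) ?_
    intro x hx
    rw [interior_Ico] at hx
    have hx' := hm x (Ioo_subset_Ico_self hx)
    exact neg_nonpos.2 (mul_nonneg (p.M_pos hq hx').le (p.K_nonneg hf hq hx' hx.1))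
  refine le_of_tendsto (p.P_top hf hq) ?_
  filter_upwards [Ioo_mem_nhdsLT hs.2] with t ht
  exact hanti hs ⟨hs.1.trans ht.1.le, ht.2⟩ ht.1.le

/-- As long as the graph starting lower stays below and flatter, its `P` is the smaller one. -/
lemma P_le_of_left (hf : Nonlin f b β Hinf D) (hq : Weight q Hinf)
    (p₁ : Profile f q β D α₁ r₁ y₁) (p₂ : Profile f q β D α₂ r₂ y₂) (hα : α₁ < α₂) {s : ℝ}
    (hs : s ∈ Ico β α₁) (hO : ∀ t ∈ Ioo s α₁, r₁ t < r₂ t ∧ y₁ t < y₂ t) :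
    P f q r₁ y₁ s ≤ P f q r₂ y₂ s := by
  have hm₁ : ∀ x ∈ Ico s α₁, x ∈ Ioo 0 α₁ := fun x hx =>
    ⟨(hf.b_pos.trans hf.b_lt).trans_le (hs.1.trans hx.1), hx.2⟩
  have hm₂ : ∀ x ∈ Ico s α₁, x ∈ Ioo 0 α₂ := fun x hx =>
    ⟨(hm₁ x hx).1, hx.2.trans hα⟩
  have hanti : AntitoneOn (fun x => P f q r₂ y₂ x - P f q r₁ y₁ x) (Ico s α₁) := by
    refine antitoneOn_of_hasDerivAt_nonpos (convex_Ico _ _) (fun x hx =>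
      (p₂.hasDerivAt_P hf hq (hm₂ x hx) (hf.b_lt.trans_le (hs.1.trans hx.1))).sub
        (p₁.hasDerivAt_P hf hq (hm₁ x hx) (hf.b_lt.trans_le (hs.1.trans hx.1)))) ?_
    intro x hx
    rw [interior_Ico] at hx
    have hx' := Ioo_subset_Ico_self hx
    have := MK_le hf hq p₁ p₂ (hm₁ x hx') (hm₂ x hx') (hs.1.trans_lt hx.1) (hO x hx).1.le
      (hO x hx).2.le
    linarith
  have hlim : Tendsto (fun t => -P f q r₁ y₁ t) (𝓝[<] α₁) (𝓝 0) := by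
    simpa using (p₁.P_top hf hq).neg
  have : 0 ≤ P f q r₂ y₂ s - P f q r₁ y₁ s := by
    refine le_of_tendsto hlim ?_
    filter_upwards [Ioo_mem_nhdsLT hs.2] with t ht
    have h1 := hanti ⟨le_rfl, hs.2⟩ ⟨ht.1.le, ht.2⟩ ht.1.le
    have h2 := p₂.P_nonneg hf hq (s := t) ⟨hs.1.trans ht.1.le, ht.2.trans hα⟩
    simp only at h1
    linarith
  linarith

lemma slope_lt_of_left (hf : Nonlin f b β Hinf D) (hq : Weight q Hinf)
    (p₁ : Profile f q β D α₁ r₁ y₁) (p₂ : Profile f q β D α₂ r₂ y₂) (hα : α₁ < α₂) {s : ℝ}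
    (hs : s ∈ Ioo 0 α₁) (hO : ∀ t ∈ Ioo s α₁, r₁ t < r₂ t ∧ y₁ t < y₂ t) : y₁ s < y₂ s := by
  obtain ⟨m, hsm, hmα⟩ := exists_between hs.2
  have hm₁ : ∀ x ∈ Icc s m, x ∈ Ioo 0 α₁ := fun x hx =>
    ⟨hs.1.trans_le hx.1, hx.2.trans_lt hmα⟩
  have hm₂ : ∀ x ∈ Icc s m, x ∈ Ioo 0 α₂ := fun x hx =>
    ⟨(hm₁ x hx).1, (hm₁ x hx).2.trans hα⟩
  have hcont : ContinuousOn (fun x => f x / (y₁ x * y₂ x)) (Icc s m) := by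
    intro x hx
    refine ContinuousAt.continuousWithinAt (ContinuousAt.div
      (hf.continuousAt (p₁.mem hf (hm₁ x hx)))
      ((p₁.continuousAt_y (hm₁ x hx)).mul (p₂.continuousAt_y (hm₂ x hx))) ?_)
    exact (mul_pos (p₁.ypos x (hm₁ x hx)) (p₂.ypos x (hm₂ x hx))).ne'
  obtain ⟨C, hC⟩ := isCompact_Icc.exists_bound_of_continuousOn hcont
  have hanti : AntitoneOn (fun x => (y₂ x - y₁ x) * Real.exp (-C * x)) (Icc s m) := by
    refine antitoneOn_of_hasDerivAt_nonpos (convex_Icc _ _) (fun x hx =>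
      ((p₂.hasDeriv_y x (hm₂ x hx)).sub (p₁.hasDeriv_y x (hm₁ x hx))).mul
        (((hasDerivAt_id x).const_mul (-C)).exp)) ?_
    intro x hx
    rw [interior_Icc] at hx
    have hx' := Ioo_subset_Icc_self hx
    have hO' := hO x ⟨hx.1, hx.2.trans hmα⟩
    have h1 := hq.quot_anti.antitoneOn (p₁.rpos x (hm₁ x hx')) (p₂.rpos x (hm₂ x hx')) hO'.1.le
    have hy₁ := p₁.ypos x (hm₁ x hx')
    have hy₂ := p₂.ypos x (hm₂ x hx')
    have h2 : f x / (y₁ x * y₂ x) ≤ C := (le_abs_self _).trans (hC x hx')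
    have h3 := mul_le_mul_of_nonneg_right h2 (sub_pos.2 hO'.2).le
    have h4 : f x / (y₁ x * y₂ x) * (y₂ x - y₁ x) = f x / y₁ x - f x / y₂ x := by
      field_simp
    simp only [id, mul_one] at h1 ⊢
    have he := Real.exp_pos (-C * x)
    have : (deriv q (r₂ x) / q (r₂ x) - f x / y₂ x - (deriv q (r₁ x) / q (r₁ x) - f x / y₁ x) -
      C * (y₂ x - y₁ x)) * Real.exp (-C * x) ≤ 0 :=
      mul_nonpos_of_nonpos_of_nonneg (by linarith) he.le
    rw [Pi.sub_apply]
    linarith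
  have h1 := hanti ⟨le_rfl, hsm.le⟩ ⟨hsm.le, le_rfl⟩ hsm.le
  have h2 : 0 < (y₂ m - y₁ m) * Real.exp (-C * m) :=
    mul_pos (sub_pos.2 (hO m ⟨hsm, hmα⟩).2) (Real.exp_pos _)
  exact sub_pos.1 (pos_of_mul_pos_left (h2.trans_le h1) (Real.exp_pos _).le)

lemma not_forall_left (hf : Nonlin f b β Hinf D) (hq : Weight q Hinf)
    (p₁ : Profile f q β D α₁ r₁ y₁) (p₂ : Profile f q β D α₂ r₂ y₂)
    (hO : ∀ t ∈ Ioo 0 b, r₁ t < r₂ t ∧ y₁ t < y₂ t) : False := by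
  have hm₁ : ∀ x ∈ Ioo 0 b, x ∈ Ioo 0 α₁ := fun x hx =>
    ⟨hx.1, (hx.2.trans hf.b_lt).trans p₁.β_lt⟩
  have hm₂ : ∀ x ∈ Ioo 0 b, x ∈ Ioo 0 α₂ := fun x hx =>
    ⟨hx.1, (hx.2.trans hf.b_lt).trans p₂.β_lt⟩
  have hanti : AntitoneOn (fun x => y₂ x - y₁ x) (Ioo 0 b) := by
    refine antitoneOn_of_hasDerivAt_nonpos (convex_Ioo _ _) (fun x hx =>
      (p₂.hasDeriv_y x (hm₂ x hx)).sub (p₁.hasDeriv_y x (hm₁ x hx))) ?_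
    intro x hx
    rw [interior_Ioo] at hx
    have h1 := hq.quot_anti.antitoneOn (p₁.rpos x (hm₁ x hx)) (p₂.rpos x (hm₂ x hx))
      (hO x hx).1.le
    have hy₁ := p₁.ypos x (hm₁ x hx)
    have hy₂ := p₂.ypos x (hm₂ x hx)
    have h2 := mul_nonpos_of_nonpos_of_nonneg (hf.fneg x hx.1.le hx.2.le)
      (sub_nonneg.2 (one_div_le_one_div_of_le hy₁ (hO x hx).2.le))
    rw [mul_sub, mul_one_div, mul_one_div] at h2
    linarith
  have hb2 : b / 2 ∈ Ioo 0 b := ⟨by linarith [hf.b_pos], by linarith [hf.b_pos]⟩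
  have hlim : Tendsto (fun x => y₂ x - y₁ x) (𝓝[>] 0) (𝓝 0) := by
    simpa using p₂.y_zero.sub p₁.y_zero
  have h1 : y₂ (b / 2) - y₁ (b / 2) ≤ 0 := by
    refine ge_of_tendsto hlim ?_
    filter_upwards [Ioo_mem_nhdsGT hb2.1] with t ht
    exact hanti ⟨ht.1, ht.2.trans hb2.2⟩ hb2 ht.2.le
  linarith [(hO _ hb2).2]

/-- Two profiles with different initial heights cross. -/
lemma exists_crossing (hf : Nonlin f b β Hinf D) (hq : Weight q Hinf)
    (p₁ : Profile f q β D α₁ r₁ y₁) (p₂ : Profile f q β D α₂ r₂ y₂) (hα : α₁ < α₂) :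
    ∃ s ∈ Ioo 0 α₁, r₁ s = r₂ s ∧ y₁ s < y₂ s ∧
      ∀ t ∈ Ioo s α₁, r₁ t < r₂ t ∧ y₁ t < y₂ t := by
  by_contra! hcon
  have hα₁ : 0 < α₁ := hf.pos_of_mem _ p₁.α_mem
  have hm : α₁ ∈ Ioo 0 α₂ := ⟨hα₁, hα⟩
  have hall : ∀ s ∈ Ioo 0 α₁, r₁ s < r₂ s ∧ y₁ s < y₂ s := by
    refine leftward_induction hα₁ ?_ ?_ ?_
    · refine Filter.Eventually.and ?_ ?_
      · exact (p₁.r_top.mono_right nhdsWithin_le_nhds).eventually_lt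
          ((p₂.continuousAt_r hm).tendsto.mono_left nhdsWithin_le_nhds) (p₂.rpos _ hm)
      · exact p₁.y_top.eventually_lt
          ((p₂.continuousAt_y hm).tendsto.mono_left nhdsWithin_le_nhds) (p₂.ypos _ hm)
    · intro s hs h
      have hs₂ : s ∈ Ioo 0 α₂ := ⟨hs.1, hs.2.trans hα⟩
      exact (((p₁.continuousAt_r hs).eventually_lt (p₂.continuousAt_r hs₂) h.1).and
        ((p₁.continuousAt_y hs).eventually_lt (p₂.continuousAt_y hs₂) h.2)).filter_mono
          nhdsWithin_le_nhds
    · intro s hs h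
      have hs₂ : s ∈ Ioo 0 α₂ := ⟨hs.1, hs.2.trans hα⟩
      have h1 := slope_lt_of_left hf hq p₁ p₂ hα hs h
      have h2 : r₁ s ≤ r₂ s := le_of_forall_Ioo_le hs.2 (p₁.continuousAt_r hs)
        (p₂.continuousAt_r hs₂) fun x hx => (h x hx).1.le
      refine ⟨h2.lt_of_ne fun h3 => ?_, h1⟩
      obtain ⟨t, ht, ht2⟩ := hcon s hs h3 h1
      exact absurd (h t ht).2 (not_lt.2 (ht2 (h t ht).1))
  exact not_forall_left hf hq p₁ p₂ fun t ht =>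
    hall t ⟨ht.1, (ht.2.trans hf.b_lt).trans p₁.β_lt⟩

end Profile

namespace Profile

variable {f q : ℝ → ℝ} {b β Hinf : ℝ} {D : Set ℝ} {α α₁ α₂ : ℝ} {r y r₁ y₁ r₂ y₂ : ℝ → ℝ}

/-- At height `β`, where `F` vanishes, `T` reduces to `(Q/q) |u'|`. -/
lemma T_β (hf : Nonlin f b β Hinf D) (hy : 0 ≤ y β) :
    T f q r y β = Qint q (r β) / q (r β) * y β := by
  unfold T
  rw [hf.Fβ, mul_zero, add_zero, Real.sqrt_sq hy]

/-- If the graph lying to the right has the same flux and at most the same `P`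
somewhere above `β`, a contradiction arises. -/
lemma not_M_eq (hf : Nonlin f b β Hinf D) (hq : Weight q Hinf)
    (p₁ : Profile f q β D α₁ r₁ y₁) (p₂ : Profile f q β D α₂ r₂ y₂) {s₁ : ℝ}
    (hβ : β < s₁) (hs₁ : s₁ < α₁) (hs₂ : s₁ < α₂) (hr : r₂ s₁ < r₁ s₁)
    (hM : M q r₁ y₁ s₁ = M q r₂ y₂ s₁) (hP : P f q r₁ y₁ s₁ ≤ P f q r₂ y₂ s₁) : False := by
  have hβ0 : 0 < β := hf.b_pos.trans hf.b_lt
  have hm₁ : ∀ x ∈ Icc β s₁, x ∈ Ioo 0 α₁ := fun x hx =>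
    ⟨hβ0.trans_le hx.1, hx.2.trans_lt hs₁⟩
  have hm₂ : ∀ x ∈ Icc β s₁, x ∈ Ioo 0 α₂ := fun x hx =>
    ⟨hβ0.trans_le hx.1, hx.2.trans_lt hs₂⟩
  have hs₁m : s₁ ∈ Icc β s₁ := ⟨hβ.le, le_rfl⟩
  set Z : ℝ → ℝ := fun s => P f q r₁ y₁ s - M q r₁ y₁ s / M q r₂ y₂ s * P f q r₂ y₂ s with hZ
  have hZd : ∀ s ∈ Icc β s₁, HasDerivAt Z (M q r₁ y₁ s * (K f q r₂ s - K f q r₁ s) +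
      M q r₁ y₁ s / M q r₂ y₂ s * (f s / y₁ s ^ 2 - f s / y₂ s ^ 2) * P f q r₂ y₂ s) s := by
    intro s hs
    have hbs := hf.b_lt.trans_le hs.1
    have hM₂ := p₂.M_pos hq (hm₂ s hs)
    refine HasDerivAt.congr_deriv ((p₁.hasDerivAt_P hf hq (hm₁ s hs) hbs).sub
      (((p₁.hasDerivAt_M hq (hm₁ s hs)).fun_div (p₂.hasDerivAt_M hq (hm₂ s hs)) hM₂.ne').mul
        (p₂.hasDerivAt_P hf hq (hm₂ s hs) hbs))) ?_
    field_simp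
    ring
  have hterm : ∀ s ∈ Icc β s₁, r₂ s ≤ r₁ s → y₁ s ≤ y₂ s →
      0 ≤ M q r₁ y₁ s * (K f q r₂ s - K f q r₁ s) := fun s hs h1 _ =>
    mul_nonneg (p₁.M_pos hq (hm₁ s hs)).le
      (sub_nonneg.2 (K_le_of_r_le hq p₁ p₂ (hm₁ s hs) (hm₂ s hs) h1))
  have hcoef : ∀ s ∈ Icc β s₁, y₁ s < y₂ s →
      0 < M q r₁ y₁ s / M q r₂ y₂ s * (f s / y₁ s ^ 2 - f s / y₂ s ^ 2) := by
    intro s hs h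
    have hy₁ := p₁.ypos s (hm₁ s hs)
    have hfs := hf.fpos s (p₁.mem hf (hm₁ s hs)) (hf.b_lt.trans_le hs.1)
    refine mul_pos (div_pos (p₁.M_pos hq (hm₁ s hs)) (p₂.M_pos hq (hm₂ s hs))) (sub_pos.2 ?_)
    gcongr
  have hZs₁ : Z s₁ ≤ 0 := by
    have hM₂ := p₂.M_pos hq (hm₂ s₁ hs₁m)
    simp only [hZ]
    rw [hM, div_self hM₂.ne']
    linarith
  have hstep : ∀ s ∈ Ico β s₁, (∀ t ∈ Ioo s s₁, r₂ t < r₁ t ∧ y₁ t < y₂ t) →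
      r₂ s < r₁ s ∧ y₁ s < y₂ s := by
    intro s hs hO
    have hs' : s ∈ Icc β s₁ := ⟨hs.1, hs.2.le⟩
    have hmono : MonotoneOn Z (Icc s s₁) := by
      refine monotoneOn_of_hasDerivAt_nonneg (convex_Icc _ _)
        (fun x hx => hZd x ⟨hs.1.trans hx.1, hx.2⟩) ?_
      intro x hx
      rw [interior_Icc] at hx
      have hx' : x ∈ Icc β s₁ := ⟨hs.1.trans hx.1.le, hx.2.le⟩
      have h := hO x hx
      exact add_nonneg (hterm x hx' h.1.le h.2.le) (mul_nonneg (hcoef x hx' h.2).le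
        (p₂.P_nonneg hf hq ⟨hx'.1, hx.2.trans hs₂⟩))
    have hZs : Z s ≤ 0 := (hmono ⟨le_rfl, hs.2.le⟩ ⟨hs.2.le, le_rfl⟩ hs.2.le).trans hZs₁
    have hgap := gap_lt p₁ p₂ (hβ0.trans_le hs.1) hs.2 hs₁ hs₂ fun x hx => (hO x hx).2
    have hrs : r₂ s < r₁ s := by linarith
    have hys : y₁ s ≤ y₂ s := le_of_forall_Ioo_le hs.2 (p₁.continuousAt_y (hm₁ s hs'))
      (p₂.continuousAt_y (hm₂ s hs')) fun x hx => (hO x hx).2.le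
    refine ⟨hrs, hys.lt_of_ne fun hyy => ?_⟩
    have hr₁ := p₁.rpos s (hm₁ s hs')
    have hr₂ := p₂.rpos s (hm₂ s hs')
    have hR := hq.ratio_strictMono hr₂ hr₁ hrs
    have hE := p₂.energy_pos hf hq (hm₂ s hs')
    have hq₁ := hq.pos _ hr₁
    have hq₂ := hq.pos _ hr₂
    have hy₂ := p₂.ypos s (hm₂ s hs')
    have h1 : Z s = q (r₁ s) * (y₂ s ^ 2 + 2 * Fint f s) *
        (Qint q (r₁ s) / q (r₁ s) - Qint q (r₂ s) / q (r₂ s)) := by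
      simp only [hZ, P, M, hyy]
      field_simp
      ring
    have h2 : 0 < Z s := by
      rw [h1]
      exact mul_pos (mul_pos hq₁ hE) (sub_pos.2 hR)
    linarith
  have hy₁₂ : y₁ s₁ < y₂ s₁ := by
    have h1 := hq.q_strictMono (p₂.rpos _ (hm₂ _ hs₁m)) (p₁.rpos _ (hm₁ _ hs₁m)) hr
    by_contra! hcon
    have h2 : M q r₂ y₂ s₁ < M q r₁ y₁ s₁ :=
      mul_lt_mul h1 hcon (p₂.ypos _ (hm₂ _ hs₁m)) (hq.pos _ (p₁.rpos _ (hm₁ _ hs₁m))).le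
    linarith
  have hopen : ∀ s ∈ Icc β s₁, r₂ s < r₁ s ∧ y₁ s < y₂ s →
      ∀ᶠ t in 𝓝[<] s, r₂ t < r₁ t ∧ y₁ t < y₂ t := fun s hs h =>
    (((p₂.continuousAt_r (hm₂ s hs)).eventually_lt (p₁.continuousAt_r (hm₁ s hs)) h.1).and
      ((p₁.continuousAt_y (hm₁ s hs)).eventually_lt (p₂.continuousAt_y (hm₂ s hs))
        h.2)).filter_mono nhdsWithin_le_nhds
  have hall : ∀ s ∈ Ioo β s₁, r₂ s < r₁ s ∧ y₁ s < y₂ s :=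
    leftward_induction hβ (hopen s₁ hs₁m ⟨hr, hy₁₂⟩)
      (fun s hs => hopen s (Ioo_subset_Icc_self hs)) (fun s hs => hstep s ⟨hs.1.le, hs.2⟩)
  have hβm : β ∈ Icc β s₁ := ⟨le_rfl, hβ.le⟩
  obtain ⟨hrβ, hyβ⟩ := hstep β ⟨le_rfl, hβ⟩ hall
  have hr₁ := p₁.rpos β (hm₁ β hβm)
  have hr₂ := p₂.rpos β (hm₂ β hβm)
  have hy₁ := p₁.ypos β (hm₁ β hβm)
  have hy₂ := p₂.ypos β (hm₂ β hβm)
  have hq₁ := hq.pos _ hr₁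
  have hq₂ := hq.pos _ hr₂
  have hP₂ : 0 < P f q r₂ y₂ β := by
    simp only [P, hf.Fβ, zero_div, mul_zero, add_zero, sub_zero]
    exact mul_pos (hq.Qpos _ hr₂) (by positivity)
  have hPev : ∀ᶠ t in 𝓝[>] β, 0 < P f q r₂ y₂ t :=
    ((p₂.hasDerivAt_P hf hq (hm₂ β hβm) hf.b_lt).continuousAt.eventually
      (lt_mem_nhds hP₂)).filter_mono nhdsWithin_le_nhds
  obtain ⟨l, hl, hlP⟩ := (mem_nhdsGT_iff_exists_Ioo_subset' hβ).1 hPev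
  obtain ⟨m, hβm', hm⟩ := exists_between (lt_min (show β < l from hl) hβ)
  have hml := hm.trans_le (min_le_left _ _)
  have hms := hm.trans_le (min_le_right _ _)
  have hZβm : Z β < Z m := by
    have : StrictMonoOn Z (Icc β m) := by
      refine strictMonoOn_of_hasDerivAt_pos (convex_Icc _ _)
        (fun x hx => hZd x ⟨hx.1, hx.2.trans hms.le⟩) ?_
      intro x hx
      rw [interior_Icc] at hx
      have hx' : x ∈ Icc β s₁ := ⟨hx.1.le, hx.2.le.trans hms.le⟩
      have h := hall x ⟨hx.1, hx.2.trans hms⟩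
      exact add_pos_of_nonneg_of_pos (hterm x hx' h.1.le h.2.le)
        (mul_pos (hcoef x hx' h.2) (hlP ⟨hx.1, hx.2.trans hml⟩))
    exact this ⟨le_rfl, hβm'.le⟩ ⟨hβm'.le, le_rfl⟩ hβm'
  have hZm : Z m ≤ Z s₁ := by
    have : MonotoneOn Z (Icc m s₁) := by
      refine monotoneOn_of_hasDerivAt_nonneg (convex_Icc _ _)
        (fun x hx => hZd x ⟨hβm'.le.trans hx.1, hx.2⟩) ?_
      intro x hx
      rw [interior_Icc] at hx
      have hx' : x ∈ Icc β s₁ := ⟨hβm'.le.trans hx.1.le, hx.2.le⟩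
      have h := hall x ⟨hβm'.trans hx.1, hx.2⟩
      exact add_nonneg (hterm x hx' h.1.le h.2.le) (mul_nonneg (hcoef x hx' h.2).le
        (p₂.P_nonneg hf hq ⟨hx'.1, hx.2.trans hs₂⟩))
    exact this ⟨le_rfl, hms.le⟩ ⟨hms.le, le_rfl⟩ hms.le
  have hZβ : Z β < 0 := by linarith
  refine not_T_lt hf hq p₁ p₂ hβ0 le_rfl hrβ.le ?_
  rw [T_β hf hy₁.le, T_β hf hy₂.le]
  have h1 : Z β = q (r₁ β) * y₁ β *
      (Qint q (r₁ β) / q (r₁ β) * y₁ β - Qint q (r₂ β) / q (r₂ β) * y₂ β) := by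
    simp only [hZ, P, M, hf.Fβ]
    field_simp
    ring
  rw [h1] at hZβ
  exact sub_neg.1 (neg_of_mul_neg_right hZβ (mul_pos hq₁ hy₁).le)

/-- Below a crossing above `β` at which `P` is ordered, a contradiction arises. -/
lemma not_crossing_above (hf : Nonlin f b β Hinf D) (hq : Weight q Hinf)
    (p₁ : Profile f q β D α₁ r₁ y₁) (p₂ : Profile f q β D α₂ r₂ y₂) {s₁ : ℝ}
    (hβ : β < s₁) (hs₁ : s₁ < α₁) (hs₂ : s₁ < α₂) (hr : r₁ s₁ = r₂ s₁)
    (hy : y₁ s₁ < y₂ s₁) (hP : P f q r₁ y₁ s₁ ≤ P f q r₂ y₂ s₁) : False := by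
  have hβ0 : 0 < β := hf.b_pos.trans hf.b_lt
  have hm₁ : ∀ x ∈ Icc β s₁, x ∈ Ioo 0 α₁ := fun x hx =>
    ⟨hβ0.trans_le hx.1, hx.2.trans_lt hs₁⟩
  have hm₂ : ∀ x ∈ Icc β s₁, x ∈ Ioo 0 α₂ := fun x hx =>
    ⟨hβ0.trans_le hx.1, hx.2.trans_lt hs₂⟩
  have hs₁m : s₁ ∈ Icc β s₁ := ⟨hβ.le, le_rfl⟩
  have hcM₁ : ∀ s ∈ Icc β s₁, ContinuousAt (M q r₁ y₁) s := fun s hs =>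
    (p₁.hasDerivAt_M hq (hm₁ s hs)).continuousAt
  have hcM₂ : ∀ s ∈ Icc β s₁, ContinuousAt (M q r₂ y₂) s := fun s hs =>
    (p₂.hasDerivAt_M hq (hm₂ s hs)).continuousAt
  have hstep : ∀ s ∈ Ico β s₁,
      (∀ t ∈ Ioo s s₁, r₂ t < r₁ t ∧ M q r₁ y₁ t < M q r₂ y₂ t) →
      r₂ s < r₁ s ∧ M q r₁ y₁ s ≤ M q r₂ y₂ s ∧ P f q r₁ y₁ s ≤ P f q r₂ y₂ s := by
    intro s hs hO
    have hs' : s ∈ Icc β s₁ := ⟨hs.1, hs.2.le⟩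
    have hyO : ∀ t ∈ Ioo s s₁, y₁ t < y₂ t := by
      intro t ht
      have ht' : t ∈ Icc β s₁ := ⟨hs.1.trans ht.1.le, ht.2.le⟩
      have h := hO t ht
      have h1 := hq.q_mono (p₂.rpos _ (hm₂ _ ht')) (p₁.rpos _ (hm₁ _ ht')) h.1.le
      by_contra! hcon
      have h2 : M q r₂ y₂ t ≤ M q r₁ y₁ t :=
        mul_le_mul h1 hcon (p₂.ypos _ (hm₂ _ ht')).le (hq.pos _ (p₁.rpos _ (hm₁ _ ht'))).le
      linarith [h.2]
    have hgap := gap_lt p₁ p₂ (hβ0.trans_le hs.1) hs.2 hs₁ hs₂ hyO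
    refine ⟨by linarith, le_of_forall_Ioo_le hs.2 (hcM₁ s hs') (hcM₂ s hs')
      fun x hx => (hO x hx).2.le, ?_⟩
    have hmono : MonotoneOn (fun x => P f q r₁ y₁ x - P f q r₂ y₂ x) (Icc s s₁) := by
      have hsub : ∀ x ∈ Icc s s₁, x ∈ Icc β s₁ := fun x hx => ⟨hs.1.trans hx.1, hx.2⟩
      refine monotoneOn_of_hasDerivAt_nonneg (convex_Icc _ _) (fun x hx =>
        (p₁.hasDerivAt_P hf hq (hm₁ x (hsub x hx)) (hf.b_lt.trans_le (hsub x hx).1)).sub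
        (p₂.hasDerivAt_P hf hq (hm₂ x (hsub x hx)) (hf.b_lt.trans_le (hsub x hx).1))) ?_
      intro x hx
      rw [interior_Icc] at hx
      have hx' := hsub x (Ioo_subset_Icc_self hx)
      have h := hO x hx
      have h1 : M q r₁ y₁ x * K f q r₁ x ≤ M q r₂ y₂ x * K f q r₂ x :=
        mul_le_mul h.2.le (K_le_of_r_le hq p₁ p₂ (hm₁ x hx') (hm₂ x hx') h.1.le)
          (p₁.K_nonneg hf hq (hm₁ x hx') (hs.1.trans_lt hx.1)) (p₂.M_pos hq (hm₂ x hx')).le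
      linarith
    have := hmono ⟨le_rfl, hs.2.le⟩ ⟨hs.2.le, le_rfl⟩ hs.2.le
    simp only at this
    linarith
  have hM : M q r₁ y₁ s₁ < M q r₂ y₂ s₁ := by
    unfold M
    rw [← hr]
    exact mul_lt_mul_of_pos_left hy (hq.pos _ (p₁.rpos _ (hm₁ _ hs₁m)))
  have hMev : ∀ s ∈ Icc β s₁, M q r₁ y₁ s < M q r₂ y₂ s →
      ∀ᶠ t in 𝓝[<] s, M q r₁ y₁ t < M q r₂ y₂ t := fun s hs h =>
    ((hcM₁ s hs).eventually_lt (hcM₂ s hs) h).filter_mono nhdsWithin_le_nhds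
  by_cases hI : ∀ s ∈ Ioo β s₁,
      (∀ t ∈ Ioo s s₁, r₂ t < r₁ t ∧ M q r₁ y₁ t < M q r₂ y₂ t) →
      r₂ s < r₁ s ∧ M q r₁ y₁ s < M q r₂ y₂ s
  · have hall : ∀ s ∈ Ioo β s₁, r₂ s < r₁ s ∧ M q r₁ y₁ s < M q r₂ y₂ s := by
      refine leftward_induction hβ ?_ ?_ hI
      · have hyc : ∀ᶠ t in 𝓝[<] s₁, y₁ t < y₂ t :=
          ((p₁.continuousAt_y (hm₁ _ hs₁m)).eventually_lt
            (p₂.continuousAt_y (hm₂ _ hs₁m)) hy).filter_mono nhdsWithin_le_nhds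
        obtain ⟨l, hl, hlO⟩ := (mem_nhdsLT_iff_exists_Ioo_subset' hβ).1 hyc
        filter_upwards [hMev s₁ hs₁m hM, Ioo_mem_nhdsLT (max_lt hl hβ)] with t ht ht'
        refine ⟨?_, ht⟩
        have := gap_lt p₁ p₂ (hβ0.trans ((le_max_right _ _).trans_lt ht'.1)) ht'.2 hs₁ hs₂
          (fun x hx => hlO ⟨(le_max_left _ _).trans_lt (ht'.1.trans hx.1), hx.2⟩)
        linarith
      · intro s hs h
        have hs' := Ioo_subset_Icc_self hs
        exact Filter.Eventually.and (((p₂.continuousAt_r (hm₂ s hs')).eventually_lt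
          (p₁.continuousAt_r (hm₁ s hs')) h.1).filter_mono nhdsWithin_le_nhds)
          (hMev s hs' h.2)
    have hβm : β ∈ Icc β s₁ := ⟨le_rfl, hβ.le⟩
    obtain ⟨hrβ, -, hPβ⟩ := hstep β ⟨le_rfl, hβ⟩ hall
    have hr₁ := p₁.rpos β (hm₁ β hβm)
    have hr₂ := p₂.rpos β (hm₂ β hβm)
    have hy₁ := p₁.ypos β (hm₁ β hβm)
    have hy₂ := p₂.ypos β (hm₂ β hβm)
    have hq₁ := hq.pos _ hr₁
    have hq₂ := hq.pos _ hr₂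
    refine not_T_lt hf hq p₁ p₂ hβ0 le_rfl hrβ.le ?_
    rw [T_β hf hy₁.le, T_β hf hy₂.le]
    simp only [P, hf.Fβ, zero_div, mul_zero, add_zero, sub_zero] at hPβ
    have hQ := hq.Q_div_sq_strictAnti hr₂ hr₁ hrβ
    have h0 := hq.Qpos _ hr₂
    have h0' := hq.Qpos _ hr₁
    have h1 : Qint q (r₁ β) / q (r₁ β) ^ 2 * (Qint q (r₁ β) * y₁ β ^ 2) <
        Qint q (r₂ β) / q (r₂ β) ^ 2 * (Qint q (r₂ β) * y₂ β ^ 2) :=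
      mul_lt_mul hQ hPβ (by positivity) (by positivity)
    refine lt_of_pow_lt_pow_left₀ 2 (mul_pos (hq.ratio_pos hr₂) hy₂).le ?_
    calc (Qint q (r₁ β) / q (r₁ β) * y₁ β) ^ 2
        = Qint q (r₁ β) / q (r₁ β) ^ 2 * (Qint q (r₁ β) * y₁ β ^ 2) := by field_simp
      _ < Qint q (r₂ β) / q (r₂ β) ^ 2 * (Qint q (r₂ β) * y₂ β ^ 2) := h1
      _ = (Qint q (r₂ β) / q (r₂ β) * y₂ β) ^ 2 := by field_simp
  · push Not at hI
    obtain ⟨s, hs, hO, hcon⟩ := hI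
    obtain ⟨h1, h2, h3⟩ := hstep s ⟨hs.1.le, hs.2⟩ hO
    exact not_M_eq hf hq p₁ p₂ hs.1 (hs.2.trans hs₁) (hs.2.trans hs₂) h1
      (h2.antisymm (hcon h1)) h3

theorem not_height_lt (hf : Nonlin f b β Hinf D) (hq : Weight q Hinf)
    (p₁ : Profile f q β D α₁ r₁ y₁) (p₂ : Profile f q β D α₂ r₂ y₂) (hα : α₁ < α₂) :
    False := by
  obtain ⟨s, hs, hr, hy, hO⟩ := exists_crossing hf hq p₁ p₂ hα
  have hs₂ : s ∈ Ioo 0 α₂ := ⟨hs.1, hs.2.trans hα⟩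
  rcases le_or_gt s β with h | h
  · refine not_T_lt hf hq p₁ p₂ hs.1 h hr.ge ?_
    unfold T
    rw [← hr]
    refine mul_lt_mul_of_pos_left ?_ (hq.ratio_pos (p₁.rpos s hs))
    have := p₁.ypos s hs
    exact Real.sqrt_lt_sqrt (p₁.energy_pos hf hq hs).le (by gcongr)
  · exact not_crossing_above hf hq p₁ p₂ h hs.2 hs₂.2 hr hy
      (P_le_of_left hf hq p₁ p₂ hα ⟨h.le, hs.2⟩ hO)

end Profile

/-- A nonnegative solution of (E) with initial height in `D` which tends to zero. -/
structure GroundState (f q : ℝ → ℝ) (D : Set ℝ) (u : ℝ → ℝ) : Prop where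
  init : u 0 ∈ D
  nonneg : ∀ r, 0 ≤ r → 0 ≤ u r
  mem : ∀ r, 0 ≤ r → 0 < u r → u r ∈ D
  cont : ContinuousOn u (Ici 0)
  hasDeriv : ∀ r, 0 < r → HasDerivAt u (deriv u r) r
  hasDeriv_deriv : ∀ r, 0 < r →
    HasDerivAt (deriv u) (-(deriv q r / q r * deriv u r) - f (u r)) r
  deriv_lim : ∃ L, Tendsto (deriv u) (𝓝[>] 0) (𝓝 L)
  lim : Tendsto u atTop (𝓝 0)

lemma IsSolutionE.groundState {c : EReal} {f q u : ℝ → ℝ} (hu : IsSolutionE c f q u)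
    (hpos : ∀ r : ℝ, 0 ≤ r → 0 ≤ u r) (hinit : 0 < u 0) (hlim : Tendsto u atTop (𝓝 0)) :
    GroundState f q {s : ℝ | 0 < s ∧ (s : EReal) < c} u where
  init := ⟨hinit, (hu.mem 0 le_rfl).2⟩
  nonneg := hpos
  mem r hr h := ⟨h, (hu.mem r hr).2⟩
  cont := hu.c1.continuousOn
  hasDeriv r hr := ((hu.c1.differentiableOn (by norm_num)).differentiableAt
    (Ici_mem_nhds hr)).hasDerivAt
  hasDeriv_deriv r hr := (hu.diff2 r hr).hasDerivAt.congr_deriv (by linarith [hu.ode r hr])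
  deriv_lim := by
    refine ⟨derivWithin u (Ici 0) 0, ?_⟩
    have h := (hu.c1.continuousOn_derivWithin (uniqueDiffOn_Ici 0) le_rfl) 0 self_mem_Ici
    have h2 := h.tendsto.mono_left (nhdsWithin_mono 0 Ioi_subset_Ici_self)
    refine h2.congr' ?_
    filter_upwards [self_mem_nhdsWithin] with r hr
    exact derivWithin_of_mem_nhds (Ici_mem_nhds hr)
  lim := hlim

namespace GroundState

variable {f q : ℝ → ℝ} {b β Hinf : ℝ} {D : Set ℝ} {u v : ℝ → ℝ}

lemma continuousAt (g : GroundState f q D u) {r : ℝ} (hr : 0 < r) : ContinuousAt u r :=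
  (g.hasDeriv r hr).continuousAt

lemma tendsto_init (g : GroundState f q D u) : Tendsto u (𝓝[>] 0) (𝓝 (u 0)) :=
  (g.cont 0 self_mem_Ici).tendsto.mono_left (nhdsWithin_mono 0 Ioi_subset_Ici_self)

lemma hasDerivAt_flux (hq : Weight q Hinf) (g : GroundState f q D u) {r : ℝ} (hr : 0 < r) :
    HasDerivAt (fun r => q r * deriv u r) (-(q r * f (u r))) r := by
  have hq0 := hq.pos r hr
  refine HasDerivAt.congr_deriv ((hq.hasDeriv r hr).mul (g.hasDeriv_deriv r hr)) ?_
  field_simp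
  ring

lemma flux_zero (hq : Weight q Hinf) (g : GroundState f q D u) :
    Tendsto (fun r => q r * deriv u r) (𝓝[>] 0) (𝓝 0) := by
  obtain ⟨L, hL⟩ := g.deriv_lim
  simpa using hq.q_zero.mul hL

lemma deriv_zero (hf : Nonlin f b β Hinf D) (hq : Weight q Hinf) (g : GroundState f q D u) :
    Tendsto (deriv u) (𝓝[>] 0) (𝓝 0) := by
  have hfu : Tendsto (fun r => f (u r)) (𝓝[>] 0) (𝓝 (f (u 0))) :=
    (hf.continuousAt g.init).tendsto.comp g.tendsto_init
  set C := |f (u 0)| + 1 with hC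
  have hev : ∀ᶠ r in 𝓝[>] (0:ℝ), |f (u r)| < C :=
    hfu.abs.eventually (gt_mem_nhds (by linarith))
  obtain ⟨δ, hδ, hδC⟩ := (mem_nhdsGT_iff_exists_Ioo_subset (a := (0:ℝ))).1 hev
  have hδ : (0:ℝ) < δ := hδ
  have hfC : ∀ r ∈ Ioo 0 δ, |f (u r)| < C := fun r hr => hδC hr
  have hbound : ∀ r ∈ Ioo 0 δ, |q r * deriv u r| ≤ C * Qint q r := by
    have hmono : MonotoneOn (fun r => q r * deriv u r + C * Qint q r) (Ioo 0 δ) := by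
      refine monotoneOn_of_hasDerivAt_nonneg (convex_Ioo 0 δ) (fun r hr =>
        (g.hasDerivAt_flux hq hr.1).add ((hq.hasDerivQ r hr.1).const_mul C)) ?_
      intro r hr
      have hr := interior_subset hr
      have := mul_nonneg (hq.pos r hr.1).le
        (show 0 ≤ C - f (u r) by linarith [(abs_lt.1 (hfC r hr)).2])
      linarith
    have hanti : AntitoneOn (fun r => q r * deriv u r - C * Qint q r) (Ioo 0 δ) := by
      refine antitoneOn_of_hasDerivAt_nonpos (convex_Ioo 0 δ) (fun r hr =>
        (g.hasDerivAt_flux hq hr.1).sub ((hq.hasDerivQ r hr.1).const_mul C)) ?_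
      intro r hr
      have hr := interior_subset hr
      have := mul_nonneg (hq.pos r hr.1).le
        (show 0 ≤ C + f (u r) by linarith [(abs_lt.1 (hfC r hr)).1])
      linarith
    have hlim₁ : Tendsto (fun r => q r * deriv u r + C * Qint q r) (𝓝[>] 0) (𝓝 0) := by
      simpa using (g.flux_zero hq).add (hq.Q_zero.const_mul C)
    have hlim₂ : Tendsto (fun r => q r * deriv u r - C * Qint q r) (𝓝[>] 0) (𝓝 0) := by
      simpa using (g.flux_zero hq).sub (hq.Q_zero.const_mul C)
    intro r hr
    have h1 : 0 ≤ q r * deriv u r + C * Qint q r := by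
      refine le_of_tendsto hlim₁ ?_
      filter_upwards [Ioo_mem_nhdsGT hr.1] with t ht
      exact hmono ⟨ht.1, ht.2.trans hr.2⟩ hr ht.2.le
    have h2 : q r * deriv u r - C * Qint q r ≤ 0 := by
      refine ge_of_tendsto hlim₂ ?_
      filter_upwards [Ioo_mem_nhdsGT hr.1] with t ht
      exact hanti ⟨ht.1, ht.2.trans hr.2⟩ hr ht.2.le
    exact abs_le.2 ⟨by linarith, by linarith⟩
  have hlin : Tendsto (fun r : ℝ => C * r) (𝓝[>] 0) (𝓝 0) := by
    have : Tendsto (fun r : ℝ => C * r) (𝓝 0) (𝓝 (C * 0)) :=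
      (continuous_const.mul continuous_id).tendsto 0
    rw [mul_zero] at this
    exact this.mono_left nhdsWithin_le_nhds
  refine squeeze_zero_norm' ?_ hlin
  filter_upwards [Ioo_mem_nhdsGT hδ] with r hr
  have hq0 := hq.pos r hr.1
  have h1 := hbound r hr
  rw [abs_mul, abs_of_pos hq0] at h1
  have h2 := mul_le_mul_of_nonneg_left (hq.Q_le r hr.1) (show 0 ≤ C by positivity)
  rw [Real.norm_eq_abs]
  refine le_of_mul_le_mul_left ?_ hq0
  linarith

lemma deriv_eq_zero (g : GroundState f q D u) {r : ℝ} (hr : 0 < r) (h : u r = 0) :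
    deriv u r = 0 := by
  refine IsLocalMin.deriv_eq_zero ?_
  filter_upwards [Ioi_mem_nhds hr] with t ht
  rw [h]
  exact g.nonneg t (le_of_lt ht)

/-- The energy along a solution. -/
def energy (f u : ℝ → ℝ) (r : ℝ) : ℝ := deriv u r ^ 2 / 2 + Fint f (u r)

lemma hasDerivAt_energy (hf : Nonlin f b β Hinf D) (g : GroundState f q D u) {r : ℝ}
    (hr : 0 < r) :
    HasDerivAt (energy f u) (-(deriv q r / q r * deriv u r ^ 2)) r := by
  have hF : HasDerivAt (fun r => Fint f (u r)) (f (u r) * deriv u r) r := by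
    rcases (g.nonneg r hr.le).lt_or_eq with h | h
    · exact (hf.hasDerivF (u r) (g.mem r hr.le h)).comp r (g.hasDeriv r hr)
    · have hd := g.hasDeriv r hr
      rw [g.deriv_eq_zero hr h.symm] at hd ⊢
      rw [mul_zero]
      obtain ⟨C, δ, hδ, hC⟩ := hf.F_small
      have hF0 : Fint f 0 = 0 := by simp [Fint]
      rw [hasDerivAt_iff_isLittleO] at hd ⊢
      rw [← h] at hd ⊢
      simp only [hF0, sub_zero, smul_zero] at hd ⊢
      refine Asymptotics.IsBigO.trans_isLittleO (Asymptotics.IsBigO.of_bound C ?_) hd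
      have hc := (g.continuousAt hr).tendsto
      rw [← h] at hc
      filter_upwards [Ioi_mem_nhds hr, hc.eventually (gt_mem_nhds hδ)] with t ht htδ
      have h0 := g.nonneg t (le_of_lt ht)
      rw [Real.norm_eq_abs, Real.norm_eq_abs, abs_of_nonneg h0]
      exact hC _ h0 htδ.le
  refine HasDerivAt.congr_deriv ((((g.hasDeriv_deriv r hr).fun_pow 2).div_const 2).add hF) ?_
  ring

lemma energy_antitone (hf : Nonlin f b β Hinf D) (hq : Weight q Hinf)
    (g : GroundState f q D u) : AntitoneOn (energy f u) (Ioi 0) := by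
  refine antitoneOn_of_hasDerivAt_nonpos (convex_Ioi 0)
    (fun r hr => g.hasDerivAt_energy hf hr) ?_
  intro r hr
  rw [interior_Ioi] at hr
  have hr : 0 < r := hr
  exact neg_nonpos.2 (mul_nonneg (div_pos (hq.dpos r hr) (hq.pos r hr)).le (sq_nonneg _))

lemma energy_nonneg (hf : Nonlin f b β Hinf D) (hq : Weight q Hinf)
    (g : GroundState f q D u) {r : ℝ} (hr : 0 < r) : 0 ≤ energy f u r := by
  obtain ⟨C, δ, hδ, hC⟩ := hf.F_small
  have hF : Tendsto (fun t => Fint f (u t)) atTop (𝓝 0) := by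
    have hlin : Tendsto (fun t => C * u t) atTop (𝓝 0) := by simpa using g.lim.const_mul C
    refine squeeze_zero_norm' ?_ hlin
    filter_upwards [eventually_ge_atTop 0, g.lim.eventually (gt_mem_nhds hδ)] with t ht htδ
    exact hC _ (g.nonneg t ht) htδ.le
  refine le_of_tendsto hF ?_
  filter_upwards [eventually_ge_atTop r] with t ht
  have h1 := g.energy_antitone hf hq hr (hr.trans_le ht) ht
  have h2 : energy f u t = deriv u t ^ 2 / 2 + Fint f (u t) := rfl
  nlinarith [sq_nonneg (deriv u t)]

lemma eq_zero_of_energy_eq_zero (hf : Nonlin f b β Hinf D) (hq : Weight q Hinf)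
    (g : GroundState f q D u) {r : ℝ} (hr : 0 < r) (h : energy f u r = 0) {t : ℝ}
    (ht : r ≤ t) : u t = 0 := by
  have hE : ∀ t, r < t → energy f u t = 0 := fun t ht =>
    le_antisymm (h ▸ g.energy_antitone hf hq hr (hr.trans ht) ht.le)
      (g.energy_nonneg hf hq (hr.trans ht))
  have hd : ∀ t, r < t → deriv u t = 0 := by
    intro t ht
    have ht0 := hr.trans ht
    have h1 : HasDerivAt (energy f u) 0 t := (hasDerivAt_const t (0:ℝ)).congr_of_eventuallyEq
      (by filter_upwards [Ioi_mem_nhds ht] with x hx using hE x hx)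
    have h2 := h1.unique (g.hasDerivAt_energy hf ht0)
    have h3 := div_pos (hq.dpos t ht0) (hq.pos t ht0)
    have h4 := (mul_eq_zero.1 (neg_eq_zero.1 h2.symm)).resolve_left h3.ne'
    exact pow_eq_zero_iff (two_ne_zero) |>.1 h4
  have hD : ∀ x ∈ Ici r, HasDerivAt u (deriv u x) x := fun x hx => g.hasDeriv x (hr.trans_le hx)
  have hconst : ∀ x, r ≤ x → u x = u r := by
    intro x hx
    refine le_antisymm ?_ ?_
    · refine antitoneOn_of_hasDerivAt_nonpos (convex_Ici r) hD ?_ self_mem_Ici hx hx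
      intro y hy
      rw [interior_Ici] at hy
      exact (hd y hy).le
    · refine monotoneOn_of_hasDerivAt_nonneg (convex_Ici r) hD ?_ self_mem_Ici hx hx
      intro y hy
      rw [interior_Ici] at hy
      exact (hd y hy).ge
  have hlim : Tendsto u atTop (𝓝 (u r)) := by
    refine tendsto_const_nhds.congr' ?_
    filter_upwards [eventually_ge_atTop r] with x hx using (hconst x hx).symm
  rw [hconst t ht]
  exact tendsto_nhds_unique hlim g.lim

lemma eq_zero_of_le (hf : Nonlin f b β Hinf D) (hq : Weight q Hinf)
    (g : GroundState f q D u) {r t : ℝ} (hr : 0 < r) (h : u r = 0) (ht : r ≤ t) : u t = 0 := by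
  refine g.eq_zero_of_energy_eq_zero hf hq hr ?_ ht
  simp [energy, g.deriv_eq_zero hr h, h, Fint]

lemma pos_of_le (hf : Nonlin f b β Hinf D) (hq : Weight q Hinf)
    (g : GroundState f q D u) {r t : ℝ} (hr : 0 ≤ r) (h : 0 < u t) (ht : r ≤ t) : 0 < u r := by
  rcases hr.lt_or_eq with h0 | h0
  · refine (g.nonneg r hr).lt_of_ne fun h1 => h.ne' (g.eq_zero_of_le hf hq h0 h1.symm ht)
  · rw [← h0]
    exact hf.pos_of_mem _ g.init

lemma energy_pos (hf : Nonlin f b β Hinf D) (hq : Weight q Hinf)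
    (g : GroundState f q D u) {r : ℝ} (hr : 0 < r) (h : 0 < u r) : 0 < energy f u r :=
  (g.energy_nonneg hf hq hr).lt_of_ne fun h1 =>
    h.ne' (g.eq_zero_of_energy_eq_zero hf hq hr h1.symm le_rfl)

lemma β_lt_init (hf : Nonlin f b β Hinf D) (hq : Weight q Hinf)
    (g : GroundState f q D u) : β < u 0 := by
  have h0 := hf.pos_of_mem _ g.init
  have hE : Tendsto (energy f u) (𝓝[>] 0) (𝓝 (Fint f (u 0))) := by
    have h1 := ((g.deriv_zero hf hq).pow 2).div_const 2
    have h2 := (hf.hasDerivF _ g.init).continuousAt.tendsto.comp g.tendsto_init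
    have := h1.add h2
    simp only [ne_eq, OfNat.ofNat_ne_zero, not_false_eq_true, zero_pow, zero_div, zero_add]
      at this
    exact this
  obtain ⟨r, hr1, hr⟩ := ((g.tendsto_init.eventually (lt_mem_nhds h0)).and
    self_mem_nhdsWithin).exists
  have hr : 0 < r := hr
  have h1 := g.energy_pos hf hq hr hr1
  have h2 : energy f u r ≤ Fint f (u 0) := by
    refine ge_of_tendsto hE ?_
    filter_upwards [Ioo_mem_nhdsGT hr] with t ht
    exact g.energy_antitone hf hq ht.1 hr ht.2.le
  by_contra! hcon
  linarith [hf.F_nonpos h0 hcon]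

lemma deriv_neg (hf : Nonlin f b β Hinf D) (hq : Weight q Hinf)
    (g : GroundState f q D u) {r : ℝ} (hr : 0 < r) (h : 0 < u r) : deriv u r < 0 := by
  by_contra! hcon
  have hfpos : ∀ t, 0 < t → b < u t → 0 < q t * f (u t) := fun t ht htb =>
    mul_pos (hq.pos t ht) (hf.fpos _ (g.mem t ht.le (hf.b_pos.trans htb)) htb)
  have hanti : ∀ s t : ℝ, 0 < s → s < t → (∀ x ∈ Icc s t, b < u x) →
      q t * deriv u t < q s * deriv u s := by
    intro s t hs hst hx
    have : StrictAntiOn (fun r => q r * deriv u r) (Icc s t) := by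
      refine strictAntiOn_of_hasDerivAt_neg (convex_Icc s t) (fun x hx =>
        g.hasDerivAt_flux hq (hs.trans_le hx.1)) ?_
      intro y hy
      have hy := interior_subset hy
      exact neg_neg_of_pos (hfpos y (hs.trans_le hy.1) (hx y hy))
    exact this ⟨le_rfl, hst.le⟩ ⟨hst.le, le_rfl⟩ hst
  obtain ⟨δ, hδ, hδb⟩ := (mem_nhdsGT_iff_exists_Ioo_subset (a := (0:ℝ))).1
    (g.tendsto_init.eventually (lt_mem_nhds (hf.b_lt.trans (g.β_lt_init hf hq))))
  have hδ : (0:ℝ) < δ := hδ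
  have hneg : ∀ t ∈ Ioo 0 δ, deriv u t < 0 := by
    intro t ht
    have ht2 : 0 < t / 2 := by linarith [ht.1]
    have h1 := hanti (t / 2) t ht2 (by linarith) fun x hx =>
      hδb ⟨by linarith [hx.1], by linarith [hx.2, ht.2]⟩
    have h2 : q (t / 2) * deriv u (t / 2) ≤ 0 := by
      refine ge_of_tendsto (g.flux_zero hq) ?_
      filter_upwards [Ioo_mem_nhdsGT ht2] with x hx
      exact (hanti x (t / 2) hx.1 hx.2 fun y hy =>
        hδb ⟨by linarith [hy.1, hx.1], by linarith [hy.2, ht.2]⟩).le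
    exact (pos_iff_neg_of_mul_neg (h1.trans_le h2)).1 (hq.pos t ht.1)
  set S := {t | t ∈ Icc (δ / 2) r ∧ 0 ≤ deriv u t} with hS
  have hδr : δ ≤ r := by
    by_contra! h'
    exact absurd (hneg r ⟨hr, h'⟩) (not_lt.2 hcon)
  have hScl : IsCompact S := by
    have hc : ContinuousOn (deriv u) (Icc (δ / 2) r) := fun x hx =>
      (g.hasDeriv_deriv x (by linarith [hx.1])).continuousAt.continuousWithinAt
    refine isCompact_Icc.of_isClosed_subset ?_ fun x hx => hx.1
    exact hc.preimage_isClosed_of_isClosed isClosed_Icc isClosed_Ici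
  obtain ⟨r₀, hr₀, hmin⟩ := hScl.exists_isLeast ⟨r, ⟨by linarith, le_rfl⟩, hcon⟩
  have hr₀0 : 0 < r₀ := by linarith [hr₀.1.1]
  have hbefore : ∀ t ∈ Ioo 0 r₀, deriv u t < 0 := by
    intro t ht
    rcases lt_or_ge t δ with h' | h'
    · exact hneg t ⟨ht.1, h'⟩
    · by_contra! h''
      exact absurd (hmin ⟨⟨by linarith, ht.2.le.trans hr₀.1.2⟩, h''⟩) (not_le.2 ht.2)
  have hd0 : deriv u r₀ = 0 := by
    refine le_antisymm ?_ hr₀.2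
    refine le_of_tendsto ((g.hasDeriv_deriv r₀ hr₀0).continuousAt.tendsto.mono_left
      (nhdsWithin_le_nhds (s := Iio r₀))) ?_
    filter_upwards [Ioo_mem_nhdsLT hr₀0] with t ht using (hbefore t ht).le
  have hu₀ : 0 < u r₀ := g.pos_of_le hf hq hr₀0.le h hr₀.1.2
  have hE := g.energy_pos hf hq hr₀0 hu₀
  have hβ : b < u r₀ := by
    refine hf.b_lt.trans ?_
    by_contra! h'
    have := hf.F_nonpos hu₀ h'
    simp only [energy, hd0] at hE
    linarith
  have hev : ∀ᶠ t in 𝓝[<] r₀, b < u t :=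
    ((g.continuousAt hr₀0).eventually (lt_mem_nhds hβ)).filter_mono nhdsWithin_le_nhds
  obtain ⟨l, hl, hlb⟩ := (mem_nhdsLT_iff_exists_Ioo_subset' hr₀0).1 hev
  obtain ⟨t, ht1, ht2⟩ := exists_between (max_lt hl hr₀0)
  have ht0 := (le_max_right _ _).trans_lt ht1
  have := hanti t r₀ ht0 ht2 fun x hx => by
    rcases hx.2.lt_or_eq with h' | h'
    · exact hlb ⟨((le_max_left _ _).trans_lt ht1).trans_le hx.1, h'⟩
    · rw [h']; exact hβ
  rw [hd0, mul_zero] at this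
  linarith [mul_neg_of_pos_of_neg (hq.pos t ht0) (hbefore t ⟨ht0, ht2⟩)]

lemma lt_of_lt (hf : Nonlin f b β Hinf D) (hq : Weight q Hinf)
    (g : GroundState f q D u) {s t : ℝ} (hs : 0 ≤ s) (hst : s < t) (h : 0 < u t) :
    u t < u s := by
  have : StrictAntiOn u (Icc s t) := by
    refine strictAntiOn_of_deriv_neg (convex_Icc s t)
      (g.cont.mono fun x hx => hs.trans hx.1) ?_
    intro x hx
    rw [interior_Icc] at hx
    exact g.deriv_neg hf hq (hs.trans_lt hx.1)
      (g.pos_of_le hf hq (hs.trans hx.1.le) h hx.2.le)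
  exact this ⟨le_rfl, hst.le⟩ ⟨hst.le, le_rfl⟩ hst

lemma le_of_le (hf : Nonlin f b β Hinf D) (hq : Weight q Hinf)
    (g : GroundState f q D u) {s t : ℝ} (hs : 0 ≤ s) (hst : s ≤ t) : u t ≤ u s := by
  rcases hst.lt_or_eq with h | h
  · rcases (g.nonneg t (hs.trans hst)).lt_or_eq with h1 | h1
    · exact (g.lt_of_lt hf hq hs h h1).le
    · rw [← h1]; exact g.nonneg s hs
  · rw [h]

end GroundState

namespace GroundState

variable {f q : ℝ → ℝ} {b β Hinf : ℝ} {D : Set ℝ} {u v : ℝ → ℝ}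

/-- The radius at which a solution first reaches the height `s`. -/
def radius (u : ℝ → ℝ) (s : ℝ) : ℝ := sInf {t | 0 ≤ t ∧ u t ≤ s}

lemma radius_spec (g : GroundState f q D u) {s : ℝ} (hs : s ∈ Ioo 0 (u 0)) :
    0 < radius u s ∧ u (radius u s) = s := by
  set S : Set ℝ := {t | 0 ≤ t ∧ u t ≤ s} with hS
  have hne : S.Nonempty := by
    obtain ⟨t, ht1, ht2⟩ := ((eventually_ge_atTop 0).and
      (g.lim.eventually (gt_mem_nhds hs.1))).exists
    exact ⟨t, ht1, ht2.le⟩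
  have hbdd : BddBelow S := ⟨0, fun t ht => ht.1⟩
  have hcl : IsClosed S := g.cont.preimage_isClosed_of_isClosed isClosed_Ici isClosed_Iic
  have hmem : radius u s ∈ S := hcl.csInf_mem hne hbdd
  have hpos : 0 < radius u s := by
    refine hmem.1.lt_of_ne fun h => ?_
    have := hmem.2
    rw [← h] at this
    exact absurd hs.2 (not_lt.2 this)
  refine ⟨hpos, le_antisymm hmem.2 ?_⟩
  refine ge_of_tendsto ((g.continuousAt hpos).tendsto.mono_left
    (nhdsWithin_le_nhds (s := Iio (radius u s)))) ?_
  filter_upwards [Ioo_mem_nhdsLT hpos] with t ht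
  by_contra! hcon
  exact absurd (csInf_le hbdd ⟨ht.1.le, hcon.le⟩) (not_le.2 ht.2)

lemma radius_lt (hf : Nonlin f b β Hinf D) (hq : Weight q Hinf) (g : GroundState f q D u)
    {s t : ℝ} (hs : s ∈ Ioo 0 (u 0)) (ht : 0 ≤ t) (h : u t < s) : radius u s < t := by
  obtain ⟨h1, h2⟩ := g.radius_spec hs
  by_contra! hcon
  exact absurd (g.le_of_le hf hq ht hcon) (by rw [h2]; exact not_le.2 h)

lemma lt_radius (hf : Nonlin f b β Hinf D) (hq : Weight q Hinf) (g : GroundState f q D u)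
    {s t : ℝ} (hs : s ∈ Ioo 0 (u 0)) (h : s < u t) : t < radius u s := by
  obtain ⟨h1, h2⟩ := g.radius_spec hs
  by_contra! hcon
  exact absurd (g.le_of_le hf hq h1.le hcon) (by rw [h2]; exact not_le.2 h)

lemma continuousAt_radius (hf : Nonlin f b β Hinf D) (hq : Weight q Hinf)
    (g : GroundState f q D u) {s : ℝ} (hs : s ∈ Ioo 0 (u 0)) : ContinuousAt (radius u) s := by
  obtain ⟨h1, h2⟩ := g.radius_spec hs
  have hdom : ∀ᶠ x in 𝓝 s, x ∈ Ioo 0 (u 0) := Ioo_mem_nhds hs.1 hs.2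
  refine tendsto_order.2 ⟨fun a ha => ?_, fun a ha => ?_⟩
  · obtain ⟨t, ht1, ht2⟩ := exists_between (max_lt ha h1)
    have hut : s < u t := by
      have := g.lt_of_lt hf hq ((le_max_right a 0).trans ht1.le) ht2 (by rw [h2]; exact hs.1)
      rwa [h2] at this
    filter_upwards [hdom, gt_mem_nhds hut] with x hx hx2
    exact ((le_max_left _ _).trans_lt ht1).trans (g.lt_radius hf hq hx hx2)
  · have hev : ∀ᶠ t in 𝓝[>] radius u s, 0 < u t :=
      ((g.continuousAt h1).eventually
        (lt_mem_nhds (by rw [h2]; exact hs.1))).filter_mono nhdsWithin_le_nhds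
    obtain ⟨t, ht1, ht2⟩ := (hev.and (Ioo_mem_nhdsGT ha)).exists
    have hut : u t < s := by
      have := g.lt_of_lt hf hq h1.le ht2.1 ht1
      rwa [h2] at this
    filter_upwards [hdom, lt_mem_nhds hut] with x hx hx2
    exact (g.radius_lt hf hq hx (h1.trans ht2.1).le hx2).trans ht2.2

lemma hasDerivAt_radius (hf : Nonlin f b β Hinf D) (hq : Weight q Hinf)
    (g : GroundState f q D u) {s : ℝ} (hs : s ∈ Ioo 0 (u 0)) :
    HasDerivAt (radius u) (deriv u (radius u s))⁻¹ s := by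
  obtain ⟨h1, h2⟩ := g.radius_spec hs
  refine HasDerivAt.of_local_left_inverse (g.continuousAt_radius hf hq hs)
    (g.hasDeriv _ h1) (g.deriv_neg hf hq h1 (by rw [h2]; exact hs.1)).ne ?_
  filter_upwards [Ioo_mem_nhds hs.1 hs.2] with x hx using (g.radius_spec hx).2

/-- The slope of a solution is small somewhere at low height. -/
lemma exists_small_slope (hf : Nonlin f b β Hinf D) (hq : Weight q Hinf)
    (g : GroundState f q D u) {ε : ℝ} (hε : 0 < ε) :
    ∃ t, 0 < t ∧ 0 < u t ∧ u t ≤ b ∧ -ε < deriv u t := by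
  by_contra! hcon
  have hb : b ∈ Ioo 0 (u 0) := ⟨hf.b_pos, hf.b_lt.trans (g.β_lt_init hf hq)⟩
  obtain ⟨h1, h2⟩ := g.radius_spec hb
  set t₀ := radius u b with ht₀
  have hslope : ∀ t, t₀ ≤ t → 0 < u t → deriv u t ≤ -ε := fun t ht hut =>
    hcon t (h1.trans_le ht) hut (h2 ▸ g.le_of_le hf hq h1.le ht)
  have hzero : ∃ t, t₀ ≤ t ∧ u t = 0 := by
    by_contra! hno
    have hpos : ∀ t, t₀ ≤ t → 0 < u t := fun t ht =>
      (g.nonneg t (h1.le.trans ht)).lt_of_ne (hno t ht).symm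
    have hanti : AntitoneOn (fun t => u t + ε * t) (Ici t₀) := by
      refine antitoneOn_of_hasDerivAt_nonpos (convex_Ici t₀) (fun t ht =>
        (g.hasDeriv t (h1.trans_le ht)).add ((hasDerivAt_id t).const_mul ε)) ?_
      intro t ht
      have ht := interior_subset ht
      linarith [hslope t ht (hpos t ht)]
    have hT : t₀ ≤ t₀ + u t₀ / ε := by
      have := div_pos (hpos t₀ le_rfl) hε
      linarith
    have h3 := hanti self_mem_Ici hT hT
    have h4 : ε * (t₀ + u t₀ / ε) = ε * t₀ + u t₀ := by field_simp
    simp only at h3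
    linarith [hpos _ hT]
  set S : Set ℝ := {t | t₀ ≤ t ∧ u t = 0} with hS
  have hcl : IsClosed S :=
    (g.cont.mono fun t (ht : t₀ ≤ t) => h1.le.trans ht).preimage_isClosed_of_isClosed
      isClosed_Ici isClosed_singleton
  have hZ := hcl.csInf_mem hzero ⟨t₀, fun t ht => ht.1⟩
  set Z := sInf S with hZdef
  have hZ0 : t₀ < Z := by
    refine hZ.1.lt_of_ne fun h => ?_
    have := hZ.2
    rw [← h, h2] at this
    exact hf.b_pos.ne' this
  have hd := (g.hasDeriv_deriv Z (h1.trans hZ0)).continuousAt.tendsto.mono_left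
    (nhdsWithin_le_nhds (s := Iio Z))
  rw [g.deriv_eq_zero (h1.trans hZ0) hZ.2] at hd
  obtain ⟨t, ht1, ht2⟩ := ((hd.eventually (lt_mem_nhds (show -ε < 0 by linarith))).and
    (Ioo_mem_nhdsLT hZ0)).exists
  have hut : 0 < u t := by
    refine (g.nonneg t (h1.trans ht2.1).le).lt_of_ne fun h => ?_
    exact absurd (csInf_le ⟨t₀, fun t ht => ht.1⟩ (show t ∈ S from ⟨ht2.1.le, h.symm⟩))
      (not_le.2 ht2.2)
  linarith [hslope t ht2.1.le hut]

/-- A ground state is described by a profile. -/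
theorem profile (hf : Nonlin f b β Hinf D) (hq : Weight q Hinf) (g : GroundState f q D u) :
    Profile f q β D (u 0) (radius u) (fun s => -deriv u (radius u s)) := by
  have hneg : ∀ s ∈ Ioo 0 (u 0), deriv u (radius u s) < 0 := fun s hs => by
    obtain ⟨h1, h2⟩ := g.radius_spec hs
    exact g.deriv_neg hf hq h1 (by rw [h2]; exact hs.1)
  have hu0 := hf.pos_of_mem _ g.init
  have htop : Tendsto (radius u) (𝓝[<] (u 0)) (𝓝[>] 0) := by
    have hdom : ∀ᶠ s in 𝓝[<] (u 0), s ∈ Ioo 0 (u 0) := Ioo_mem_nhdsLT hu0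
    refine tendsto_nhdsWithin_iff.2 ⟨tendsto_order.2 ⟨fun a ha => ?_, fun a ha => ?_⟩, ?_⟩
    · filter_upwards [hdom] with s hs using ha.trans (g.radius_spec hs).1
    · obtain ⟨t, ht1, ht2⟩ := ((g.tendsto_init.eventually (lt_mem_nhds hu0)).and
        (Ioo_mem_nhdsGT ha)).exists
      have hut := g.lt_of_lt hf hq le_rfl ht2.1 ht1
      filter_upwards [hdom, Ioo_mem_nhdsLT hut] with s hs hs2
      exact (g.radius_lt hf hq hs ht2.1.le hs2.1).trans ht2.2
    · filter_upwards [hdom] with s hs using (g.radius_spec hs).1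
  refine ⟨g.init, g.β_lt_init hf hq, fun s hs => (g.radius_spec hs).1,
    fun s hs => neg_pos.2 (hneg s hs), fun s hs => ?_, fun s hs => ?_, htop, ?_, ?_⟩
  · refine (g.hasDerivAt_radius hf hq hs).congr_deriv ?_
    have := (hneg s hs).ne
    field_simp
  · obtain ⟨h1, h2⟩ := g.radius_spec hs
    refine (((g.hasDeriv_deriv _ h1).comp s (g.hasDerivAt_radius hf hq hs)).neg).congr_deriv ?_
    have h3 := (hneg s hs).ne
    have h4 := (hq.pos _ h1).ne'
    rw [h2]
    field_simp
    ring
  · simpa using ((g.deriv_zero hf hq).comp htop).neg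
  · refine tendsto_order.2 ⟨fun a ha => ?_, fun a ha => ?_⟩
    · filter_upwards [Ioo_mem_nhdsGT hu0] with s hs using ha.trans (neg_pos.2 (hneg s hs))
    · obtain ⟨t, ht, hut, hutb, hd⟩ := g.exists_small_slope hf hq ha
      have hut0 : u t < u 0 := hutb.trans_lt (hf.b_lt.trans (g.β_lt_init hf hq))
      filter_upwards [Ioo_mem_nhdsGT hut] with s hs
      have hs' : s ∈ Ioo 0 (u 0) := ⟨hs.1, hs.2.trans hut0⟩
      obtain ⟨h1, h2⟩ := g.radius_spec hs'
      have htr := g.lt_radius hf hq hs' hs.2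
      have hmono : MonotoneOn (deriv u) (Icc t (radius u s)) := by
        refine monotoneOn_of_hasDerivAt_nonneg (convex_Icc _ _)
          (fun x hx => g.hasDeriv_deriv x (ht.trans_le hx.1)) ?_
        intro x hx
        have hx := interior_subset hx
        have hx0 := ht.trans_le hx.1
        have hux : 0 < u x := g.pos_of_le hf hq hx0.le (by rw [h2]; exact hs.1) hx.2
        have h3 := hf.fneg (u x) hux.le ((g.le_of_le hf hq ht.le hx.1).trans hutb)
        have h4 := mul_neg_of_pos_of_neg (div_pos (hq.dpos x hx0) (hq.pos x hx0))
          (g.deriv_neg hf hq hx0 hux)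
        linarith
      have := hmono ⟨le_rfl, htr.le⟩ ⟨htr.le, le_rfl⟩ htr.le
      linarith

/-- Solutions with the same initial height agree as long as they are positive. -/
lemma eq_of_init_eq_of_pos (hf : Nonlin f b β Hinf D) (hq : Weight q Hinf)
    (g : GroundState f q D u) (g' : GroundState f q D v) (h : u 0 = v 0) {T : ℝ} (hT : 0 < T)
    (hu : 0 < u T) (hv : 0 < v T) : u T = v T := by
  set m := min (u T) (v T) with hm
  have hm0 : 0 < m := lt_min hu hv
  have hsub : Icc m (u 0) ⊆ D := fun x hx => hf.down _ g.init x (hm0.trans_le hx.1) hx.2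
  have hfd : ∀ x ∈ D, DifferentiableAt ℝ f x := fun x hx =>
    (hf.smooth.differentiableOn (by norm_num)).differentiableAt (hf.isOpen.mem_nhds hx)
  obtain ⟨L, hL⟩ := isCompact_Icc.exists_bound_of_continuousOn
    ((hf.smooth.continuousOn_deriv_of_isOpen hf.isOpen le_rfl).mono hsub)
  have hLip : ∀ x ∈ Icc m (u 0), ∀ y ∈ Icc m (u 0), ‖f y - f x‖ ≤ L * ‖y - x‖ :=
    fun x hx y hy => (convex_Icc m (u 0)).norm_image_sub_le_of_norm_deriv_le
      (fun z hz => hfd z (hsub hz)) hL hx hy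
  have hru : ∀ t ∈ Icc 0 T, u t ∈ Icc m (u 0) := fun t ht =>
    ⟨(min_le_left _ _).trans (g.le_of_le hf hq ht.1 ht.2), g.le_of_le hf hq le_rfl ht.1⟩
  have hrv : ∀ t ∈ Icc 0 T, v t ∈ Icc m (u 0) := fun t ht =>
    ⟨(min_le_right _ _).trans (g'.le_of_le hf hq ht.1 ht.2),
      h ▸ g'.le_of_le hf hq le_rfl ht.1⟩
  set N : ℝ → ℝ := fun t => (deriv u t - deriv v t) ^ 2 + (u t - v t) ^ 2 with hN
  have hanti : AntitoneOn (fun t => N t * Real.exp (-(L + 1) * t)) (Ioc 0 T) := by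
    refine antitoneOn_of_hasDerivAt_nonpos (convex_Ioc _ _) (fun t ht =>
      ((((g.hasDeriv_deriv t ht.1).fun_sub (g'.hasDeriv_deriv t ht.1)).fun_pow 2).fun_add
        (((g.hasDeriv t ht.1).fun_sub (g'.hasDeriv t ht.1)).fun_pow 2)).mul
        (((hasDerivAt_id t).const_mul (-(L + 1))).exp)) ?_
    intro t ht
    have ht := interior_subset ht
    have ht' : t ∈ Icc 0 T := ⟨ht.1.le, ht.2⟩
    have h1 := hLip _ (hrv t ht') _ (hru t ht')
    rw [Real.norm_eq_abs, Real.norm_eq_abs] at h1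
    have hL0 : 0 ≤ L := (norm_nonneg _).trans (hL _ (hru t ht'))
    have ha := div_pos (hq.dpos t ht.1) (hq.pos t ht.1)
    set d := u t - v t with hd
    set e := deriv u t - deriv v t with he
    have h2 : -(e * (f (u t) - f (v t))) ≤ L * (|e| * |d|) := by
      calc -(e * (f (u t) - f (v t))) ≤ |e * (f (u t) - f (v t))| := neg_le_abs _
        _ = |e| * |f (u t) - f (v t)| := abs_mul _ _
        _ ≤ |e| * (L * |d|) := by gcongr
        _ = L * (|e| * |d|) := by ring
    have h3 : 2 * (|e| * |d|) ≤ e ^ 2 + d ^ 2 := by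
      nlinarith [sq_nonneg (|e| - |d|), sq_abs e, sq_abs d]
    have h4 : e * d ≤ |e| * |d| := by rw [← abs_mul]; exact le_abs_self _
    have h5 := mul_le_mul_of_nonneg_left h3 hL0
    have h6 := mul_nonneg ha.le (sq_nonneg e)
    have hmain : 2 * e * (-(deriv q t / q t * e) - (f (u t) - f (v t))) + 2 * d * e ≤
        (L + 1) * (e ^ 2 + d ^ 2) := by nlinarith
    have he0 := Real.exp_pos (-(L + 1) * t)
    have hfin := mul_nonpos_of_nonpos_of_nonneg (sub_nonpos.2 hmain) he0.le
    refine le_trans (le_of_eq ?_) hfin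
    simp only [id, he, hd]
    push_cast
    ring
  have hlim : Tendsto (fun t => N t * Real.exp (-(L + 1) * t)) (𝓝[>] 0) (𝓝 0) := by
    have h1 := ((g.deriv_zero hf hq).sub (g'.deriv_zero hf hq)).pow 2
    have h2 := (g.tendsto_init.sub g'.tendsto_init).pow 2
    have h3 : Tendsto (fun t : ℝ => Real.exp (-(L + 1) * t)) (𝓝[>] 0)
        (𝓝 (Real.exp (-(L + 1) * 0))) :=
      (Continuous.tendsto (by fun_prop) 0).mono_left nhdsWithin_le_nhds
    have := (h1.add h2).mul h3
    simpa [h] using this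
  have hNT : N T * Real.exp (-(L + 1) * T) ≤ 0 := by
    refine ge_of_tendsto hlim ?_
    filter_upwards [Ioo_mem_nhdsGT hT] with t ht
    exact hanti ⟨ht.1, ht.2.le⟩ ⟨hT, le_rfl⟩ ht.2.le
  have hNT' : N T ≤ 0 := nonpos_of_mul_nonpos_left hNT (Real.exp_pos _)
  have : (u T - v T) ^ 2 ≤ 0 := by
    simp only [hN] at hNT'
    linarith [sq_nonneg (deriv u T - deriv v T)]
  exact sub_eq_zero.1 (pow_eq_zero_iff two_ne_zero |>.1 (le_antisymm this (sq_nonneg _)))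

lemma pos_of_init_eq (hf : Nonlin f b β Hinf D) (hq : Weight q Hinf)
    (g : GroundState f q D u) (g' : GroundState f q D v) (h : u 0 = v 0) {r : ℝ} (hr : 0 < r)
    (hv : 0 < v r) : 0 < u r := by
  by_contra! hu
  have hv0 := g'.le_of_le hf hq le_rfl hr.le
  have hs : v r / 2 ∈ Icc (u r) (u 0) := ⟨by linarith, by rw [h]; linarith⟩
  obtain ⟨t, ht, htv⟩ := intermediate_value_Icc' hr.le
    (g.cont.mono fun x (hx : x ∈ Icc 0 r) => hx.1) hs
  have hvt := g'.le_of_le hf hq ht.1 ht.2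
  rcases ht.1.lt_or_eq with h0 | h0
  · have := g.eq_of_init_eq_of_pos hf hq g' h h0 (by linarith) (by linarith)
    linarith
  · rw [← h0, h] at htv
    linarith

theorem eq_of_init_eq (hf : Nonlin f b β Hinf D) (hq : Weight q Hinf)
    (g : GroundState f q D u) (g' : GroundState f q D v) (h : u 0 = v 0) {r : ℝ}
    (hr : 0 ≤ r) : u r = v r := by
  rcases hr.lt_or_eq with h0 | h0
  · rcases (g.nonneg r hr).lt_or_eq with hu | hu
    · exact g.eq_of_init_eq_of_pos hf hq g' h h0 hu (g'.pos_of_init_eq hf hq g h.symm h0 hu)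
    · rcases (g'.nonneg r hr).lt_or_eq with hv | hv
      · exact absurd hu (g.pos_of_init_eq hf hq g' h h0 hv).ne
      · rw [← hu, ← hv]
  · rw [← h0, h]

end GroundState

/-- Under (f1)-(f3) and (q1)-(q3), the bound state problem has at
most one nonnegative solution with positive initial value. -/
theorem uniqueness_ground_state_subcritical
    (c : EReal) (f q : ℝ → ℝ) (b β Hinf : ℝ) (hc : 0 < c)
    (hf1 : CondF1 c f b β) (hf2 : CondF2 c f)
    (hq1 : CondQ1 q) (hq2 : CondQ2 q) (hq3 : CondQ3 q Hinf)
    (hf3 : CondF3 c f β Hinf)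
    (u₁ u₂ : ℝ → ℝ)
    (hu₁ : IsSolutionE c f q u₁) (hu₂ : IsSolutionE c f q u₂)
    (hpos₁ : ∀ r : ℝ, 0 ≤ r → 0 ≤ u₁ r) (hpos₂ : ∀ r : ℝ, 0 ≤ r → 0 ≤ u₂ r)
    (hinit₁ : 0 < u₁ 0) (hinit₂ : 0 < u₂ 0)
    (hlim₁ : Tendsto u₁ atTop (nhds 0)) (hlim₂ : Tendsto u₂ atTop (nhds 0)) :
    ∀ r : ℝ, 0 ≤ r → u₁ r = u₂ r := by
  have hf := nonlin_of_conditions hf1 hf2 hf3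
  have hq := weight_of_conditions hq1 hq2 hq3
  have g₁ := hu₁.groundState hpos₁ hinit₁ hlim₁
  have g₂ := hu₂.groundState hpos₂ hinit₂ hlim₂
  intro r hr
  rcases lt_trichotomy (u₁ 0) (u₂ 0) with h | h | h
  · exact (Profile.not_height_lt hf hq (g₁.profile hf hq) (g₂.profile hf hq) h).elim
  · exact g₁.eq_of_init_eq hf hq g₂ h hr
  · exact (Profile.not_height_lt hf hq (g₂.profile hf hq) (g₁.profile hf hq) h).elim
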